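/- arXiv:2308.11586 — 2 statements merged into one kernel-verified Lean document; each statement's English description precedes it below -/
import Mathlib

section
/- Let 𝒜 be an uncountable almost disjoint family of infinite subsets of ℕ, and let X_𝒜 be the closed linear span in ℓ∞ of the indicator functions 1_A for A ∈ 𝒜 together with the indicator functions 1_{{n}} for n ∈ ℕ. Then for every C > 4 and every non-compact bounded linear operator T on X_𝒜 with essential norm ‖T‖ₑ = 1, there exist bounded linear operators U : X_𝒜 → c₀ and V : c₀ → X_𝒜 such that U∘T∘V = I_{c₀} and ‖U‖·‖V‖ < C. -/
open scoped ENNReal ZeroAtInfty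

set_option synthInstance.maxHeartbeats 1000000
set_option maxHeartbeats 1000000

/-- The indicator function of a set `A ⊆ ℕ`, viewed as an element of `ℓ∞`. -/
noncomputable def indLinf (𝕜 : Type*) [RCLike 𝕜] (A : Set ℕ) : lp (fun _ : ℕ => 𝕜) ∞ :=
  ⟨A.indicator fun _ => 1, memℓp_infty ⟨1, by
    rintro x ⟨n, rfl⟩
    by_cases h : n ∈ A <;> simp [Set.indicator, h]⟩⟩

/-- The space `X_𝒜`: the closed linear span in `ℓ∞` of the indicator functions `1_A` for
`A ∈ 𝒜` together with the indicator functions `1_{{n}}` for `n ∈ ℕ`. -/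
noncomputable def XA (𝕜 : Type*) [RCLike 𝕜] (𝒜 : Set (Set ℕ)) :
    Submodule 𝕜 (lp (fun _ : ℕ => 𝕜) ∞) :=
  (Submodule.span 𝕜 ((fun A => indLinf 𝕜 A) '' 𝒜 ∪
      Set.range fun n : ℕ => indLinf 𝕜 {n})).topologicalClosure

section SpaceXA

open Filter Topology

variable {𝕜 : Type*} [RCLike 𝕜] {𝒜 : Set (Set ℕ)}

lemma indLinf_apply (A : Set ℕ) (n : ℕ) :
    (indLinf 𝕜 A : ∀ _ : ℕ, 𝕜) n = A.indicator (fun _ => (1 : 𝕜)) n := rfl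

lemma indLinf_mem_XA {A : Set ℕ} (hA : A ∈ 𝒜) : indLinf 𝕜 A ∈ XA 𝕜 𝒜 :=
  Submodule.le_topologicalClosure _ (Submodule.subset_span (Or.inl ⟨A, hA, rfl⟩))

lemma indLinf_singleton_mem_XA (n : ℕ) : indLinf 𝕜 {n} ∈ XA 𝕜 𝒜 :=
  Submodule.le_topologicalClosure _ (Submodule.subset_span (Or.inr ⟨n, rfl⟩))

lemma XA_le_of_isClosed {W : Submodule 𝕜 (lp (fun _ : ℕ => 𝕜) ∞)}
    (hW : IsClosed (W : Set (lp (fun _ : ℕ => 𝕜) ∞)))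
    (hA : ∀ A ∈ 𝒜, indLinf 𝕜 A ∈ W) (hn : ∀ n : ℕ, indLinf 𝕜 {n} ∈ W) : XA 𝕜 𝒜 ≤ W := by
  refine Submodule.topologicalClosure_minimal _ (Submodule.span_le.2 ?_) hW
  rintro _ (⟨A, h, rfl⟩ | ⟨n, rfl⟩)
  exacts [hA A h, hn n]

lemma exists_tendsto_ultrafilter (u : Ultrafilter ℕ) (f : lp (fun _ : ℕ => 𝕜) ∞) :
    ∃ c : 𝕜, ‖c‖ ≤ ‖f‖ ∧ Tendsto (fun n => (f : ∀ _ : ℕ, 𝕜) n) u (𝓝 c) := by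
  obtain ⟨c, hc, h⟩ := (isCompact_closedBall (0 : 𝕜) ‖f‖).ultrafilter_le_nhds'
    (u.map fun n => (f : ∀ _ : ℕ, 𝕜) n)
    (mem_map.2 <| univ_mem' fun n => by
      simpa using lp.norm_apply_le_norm ENNReal.top_ne_zero f n)
  exact ⟨c, by simpa using hc, h⟩

/-- The limit of bounded sequences along an ultrafilter. -/
noncomputable def ultraLim (𝕜 : Type*) [RCLike 𝕜] (u : Ultrafilter ℕ) :
    lp (fun _ : ℕ => 𝕜) ∞ →L[𝕜] 𝕜 :=
  LinearMap.mkContinuous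
    { toFun := fun f => (exists_tendsto_ultrafilter u f).choose
      map_add' := fun f g =>
        tendsto_nhds_unique (exists_tendsto_ultrafilter u (f + g)).choose_spec.2
          ((exists_tendsto_ultrafilter u f).choose_spec.2.add
            (exists_tendsto_ultrafilter u g).choose_spec.2)
      map_smul' := fun c f =>
        tendsto_nhds_unique (exists_tendsto_ultrafilter u (c • f)).choose_spec.2
          ((exists_tendsto_ultrafilter u f).choose_spec.2.const_smul c) } 1
    fun f => by simpa using (exists_tendsto_ultrafilter u f).choose_spec.1

lemma tendsto_ultraLim (u : Ultrafilter ℕ) (f : lp (fun _ : ℕ => 𝕜) ∞) :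
    Tendsto (fun n => (f : ∀ _ : ℕ, 𝕜) n) u (𝓝 (ultraLim 𝕜 u f)) :=
  (exists_tendsto_ultrafilter u f).choose_spec.2

lemma norm_ultraLim_le (u : Ultrafilter ℕ) : ‖ultraLim 𝕜 u‖ ≤ 1 :=
  LinearMap.mkContinuous_norm_le _ zero_le_one fun f => by
    simpa using (exists_tendsto_ultrafilter u f).choose_spec.1

lemma norm_ultraLim_apply_le (u : Ultrafilter ℕ) (f : lp (fun _ : ℕ => 𝕜) ∞) :
    ‖ultraLim 𝕜 u f‖ ≤ ‖f‖ := by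
  simpa using (ultraLim 𝕜 u).le_of_opNorm_le (norm_ultraLim_le u) f

lemma ultraLim_eq_of_tendsto {u : Ultrafilter ℕ} {f : lp (fun _ : ℕ => 𝕜) ∞} {c : 𝕜}
    (h : Tendsto (fun n => (f : ∀ _ : ℕ, 𝕜) n) u (𝓝 c)) : ultraLim 𝕜 u f = c :=
  tendsto_nhds_unique (tendsto_ultraLim u f) h

lemma ultraLim_pure (n : ℕ) (f : lp (fun _ : ℕ => 𝕜) ∞) :
    ultraLim 𝕜 (pure n) f = (f : ∀ _ : ℕ, 𝕜) n :=
  ultraLim_eq_of_tendsto (tendsto_pure_nhds _ n)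

/-- Convergence along a filter to a prescribed continuous functional passes from the generators
to the whole space `X_𝒜`. -/
lemma tendsto_of_mem_XA {l : Filter ℕ} (φ : lp (fun _ : ℕ => 𝕜) ∞ →L[𝕜] 𝕜)
    (hA : ∀ A ∈ 𝒜, Tendsto (A.indicator fun _ => (1 : 𝕜)) l (𝓝 (φ (indLinf 𝕜 A))))
    (hn : ∀ n : ℕ, Tendsto (Set.indicator {n} fun _ => (1 : 𝕜)) l (𝓝 (φ (indLinf 𝕜 {n}))))
    {f : lp (fun _ : ℕ => 𝕜) ∞} (hf : f ∈ XA 𝕜 𝒜) :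
    Tendsto (fun n => (f : ∀ _ : ℕ, 𝕜) n) l (𝓝 (φ f)) := by
  rw [tendsto_iff_ultrafilter]
  intro u hu
  have hle : XA 𝕜 𝒜 ≤ LinearMap.ker (ultraLim 𝕜 u - φ).toLinearMap := by
    refine XA_le_of_isClosed (ContinuousLinearMap.isClosed_ker _) (fun A h => ?_) fun n => ?_
    · simpa [sub_eq_zero] using ultraLim_eq_of_tendsto ((hA A h).mono_left hu)
    · simpa [sub_eq_zero] using ultraLim_eq_of_tendsto ((hn n).mono_left hu)
  have h := hle hf
  rw [LinearMap.mem_ker, ContinuousLinearMap.coe_coe, sub_apply, sub_eq_zero] at h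
  exact h ▸ tendsto_ultraLim u f

/-- The neighbourhood filter, traced on `ℕ`, of the point at infinity of the set `A`. -/
def endFilter (A : Set ℕ) : Filter ℕ := cofinite ⊓ 𝓟 A

open Classical in
/-- Evaluation at the point at infinity of the set `A`. -/
noncomputable def endEval (𝕜 : Type*) [RCLike 𝕜] (A : Set ℕ) :
    lp (fun _ : ℕ => 𝕜) ∞ →L[𝕜] 𝕜 :=
  if _ : (endFilter A).NeBot then ultraLim 𝕜 (Ultrafilter.of (endFilter A)) else 0

lemma norm_endEval_le (A : Set ℕ) : ‖endEval 𝕜 A‖ ≤ 1 := by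
  unfold endEval
  split_ifs
  · exact norm_ultraLim_le _
  · simp

lemma norm_endEval_apply_le (A : Set ℕ) (f : lp (fun _ : ℕ => 𝕜) ∞) :
    ‖endEval 𝕜 A f‖ ≤ ‖f‖ := by
  simpa using (endEval 𝕜 A).le_of_opNorm_le (norm_endEval_le A) f

lemma endFilter_neBot {A : Set ℕ} (hA : A.Infinite) : (endFilter A).NeBot :=
  cofinite_inf_principal_neBot_iff.2 hA

lemma endEval_eq_of_tendsto {A : Set ℕ} (hA : A.Infinite) {f : lp (fun _ : ℕ => 𝕜) ∞} {c : 𝕜}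
    (h : Tendsto (fun n => (f : ∀ _ : ℕ, 𝕜) n) (endFilter A) (𝓝 c)) : endEval 𝕜 A f = c := by
  have := endFilter_neBot hA
  rw [endEval, dif_pos this]
  exact ultraLim_eq_of_tendsto (h.mono_left (Ultrafilter.of_le _))

lemma eventually_endFilter_mem (A : Set ℕ) : ∀ᶠ n in endFilter A, n ∈ A :=
  mem_inf_of_right (mem_principal_self A)

lemma eventually_endFilter_notMem {A F : Set ℕ} (hF : (A ∩ F).Finite) :
    ∀ᶠ n in endFilter A, n ∉ F := by
  filter_upwards [eventually_endFilter_mem A,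
    mem_inf_of_left (g := 𝓟 A) hF.compl_mem_cofinite] with n h1 h2 h3 using h2 ⟨h1, h3⟩

lemma tendsto_indicator_endFilter_self (A : Set ℕ) :
    Tendsto (A.indicator fun _ => (1 : 𝕜)) (endFilter A) (𝓝 1) :=
  tendsto_const_nhds.congr' <| (eventually_endFilter_mem A).mono fun n hn => by simp [hn]

lemma tendsto_indicator_endFilter {A B : Set ℕ} (h : (A ∩ B).Finite) :
    Tendsto (B.indicator fun _ => (1 : 𝕜)) (endFilter A) (𝓝 0) :=
  tendsto_const_nhds.congr' <| (eventually_endFilter_notMem h).mono fun n hn => by simp [hn]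

lemma endEval_indLinf_self {A : Set ℕ} (hA : A.Infinite) : endEval 𝕜 A (indLinf 𝕜 A) = 1 :=
  endEval_eq_of_tendsto hA (tendsto_indicator_endFilter_self A)

lemma endEval_indLinf {A B : Set ℕ} (hA : A.Infinite) (h : (A ∩ B).Finite) :
    endEval 𝕜 A (indLinf 𝕜 B) = 0 :=
  endEval_eq_of_tendsto hA (tendsto_indicator_endFilter h)

lemma tendsto_endEval (h_inf : ∀ A ∈ 𝒜, A.Infinite)
    (h_ad : ∀ A ∈ 𝒜, ∀ A' ∈ 𝒜, A ≠ A' → (A ∩ A').Finite) {A : Set ℕ} (hA : A ∈ 𝒜)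
    {f : lp (fun _ : ℕ => 𝕜) ∞} (hf : f ∈ XA 𝕜 𝒜) :
    Tendsto (fun n => (f : ∀ _ : ℕ, 𝕜) n) (endFilter A) (𝓝 (endEval 𝕜 A f)) := by
  refine tendsto_of_mem_XA _ (fun B hB => ?_) (fun n => ?_) hf
  · rcases eq_or_ne A B with rfl | hAB
    · rw [endEval_indLinf_self (h_inf A hA)]
      exact tendsto_indicator_endFilter_self A
    · rw [endEval_indLinf (h_inf A hA) (h_ad A hA B hB hAB)]
      exact tendsto_indicator_endFilter (h_ad A hA B hB hAB)
  · have : (A ∩ {n}).Finite := (Set.finite_singleton n).inter_of_right A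
    rw [endEval_indLinf (h_inf A hA) this]
    exact tendsto_indicator_endFilter this

lemma tendsto_zero_of_mem_XA {l : Filter ℕ} (hl : l ≤ cofinite) (h : ∀ A ∈ 𝒜, Aᶜ ∈ l)
    {f : lp (fun _ : ℕ => 𝕜) ∞} (hf : f ∈ XA 𝕜 𝒜) :
    Tendsto (fun n => (f : ∀ _ : ℕ, 𝕜) n) l (𝓝 0) := by
  refine tendsto_of_mem_XA 0 (fun A hA => ?_) (fun n => ?_) hf
  · refine tendsto_const_nhds.congr' ?_
    filter_upwards [h A hA] with n hn
    exact (Set.indicator_of_notMem hn _).symm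
  · refine tendsto_const_nhds.congr' ?_
    filter_upwards [hl (Set.finite_singleton n).compl_mem_cofinite] with m hm
    exact (Set.indicator_of_notMem hm _).symm

lemma countable_endEval_ne_zero (h_inf : ∀ A ∈ 𝒜, A.Infinite)
    (h_ad : ∀ A ∈ 𝒜, ∀ A' ∈ 𝒜, A ≠ A' → (A ∩ A').Finite)
    {f : lp (fun _ : ℕ => 𝕜) ∞} (hf : f ∈ XA 𝕜 𝒜) :
    {A | A ∈ 𝒜 ∧ endEval 𝕜 A f ≠ 0}.Countable := by
  have hspan : ∀ g ∈ Submodule.span 𝕜 ((fun A => indLinf 𝕜 A) '' 𝒜 ∪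
      Set.range fun n : ℕ => indLinf 𝕜 {n}), {A | A ∈ 𝒜 ∧ endEval 𝕜 A g ≠ 0}.Countable := by
    intro g hg
    induction hg using Submodule.span_induction with
    | mem x hx =>
      rcases hx with ⟨B, hB, rfl⟩ | ⟨n, rfl⟩
      · refine (Set.countable_singleton B).mono fun A hA => ?_
        by_contra hAB
        exact hA.2 (endEval_indLinf (h_inf A hA.1) (h_ad A hA.1 B hB hAB))
      · refine Set.countable_empty.mono fun A hA => ?_
        exact hA.2 (endEval_indLinf (h_inf A hA.1) ((Set.finite_singleton n).inter_of_right A))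
    | zero => simp
    | add x y _ _ hx hy =>
      refine (hx.union hy).mono fun A hA => ?_
      by_contra h
      simp only [Set.mem_union, Set.mem_ofPred_eq, not_or, not_and, not_not] at h
      exact hA.2 (by rw [map_add, h.1 hA.1, h.2 hA.1, add_zero])
    | smul c x _ hx =>
      refine hx.mono fun A hA => ?_
      by_contra h
      simp only [Set.mem_ofPred_eq, not_and, not_not] at h
      exact hA.2 (by rw [map_smul, h hA.1, smul_zero])
  obtain ⟨g, hg, hlim⟩ := mem_closure_iff_seq_limit.1 hf
  refine (Set.countable_iUnion fun j => hspan (g j) (hg j)).mono fun A hA => ?_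
  by_contra h
  simp only [Set.mem_iUnion, Set.mem_ofPred_eq, not_exists, not_and, not_not] at h
  refine hA.2 (tendsto_nhds_unique (((endEval 𝕜 A).continuous.tendsto f).comp hlim) ?_)
  exact tendsto_const_nhds.congr fun j => (h j hA.1).symm

lemma indLinf_mul (A B : Set ℕ) : indLinf 𝕜 A * indLinf 𝕜 B = indLinf 𝕜 (A ∩ B) := by
  ext n
  rw [lp.infty_coeFn_mul, Pi.mul_apply, indLinf_apply, indLinf_apply, indLinf_apply]
  by_cases hA : n ∈ A <;> by_cases hB : n ∈ B <;> simp [hA, hB]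

lemma mul_indLinf_apply (f : lp (fun _ : ℕ => 𝕜) ∞) (S : Set ℕ) (n : ℕ) :
    ((f * indLinf 𝕜 S : lp (fun _ : ℕ => 𝕜) ∞) : ∀ _ : ℕ, 𝕜) n =
      S.indicator (fun m => (f : ∀ _ : ℕ, 𝕜) m) n := by
  rw [lp.infty_coeFn_mul, Pi.mul_apply, indLinf_apply]
  by_cases hS : n ∈ S <;> simp [hS]

lemma indLinf_finset_mem_XA (F : Finset ℕ) : indLinf 𝕜 (F : Set ℕ) ∈ XA 𝕜 𝒜 := by
  have : indLinf 𝕜 (F : Set ℕ) = ∑ n ∈ F, indLinf 𝕜 {n} := by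
    ext m
    rw [lp.coeFn_sum, Finset.sum_apply]
    simp [indLinf_apply, Set.indicator_apply]
  rw [this]
  exact Submodule.sum_mem _ fun n _ => indLinf_singleton_mem_XA n

lemma indLinf_mem_XA_of_finite {F : Set ℕ} (hF : F.Finite) : indLinf 𝕜 F ∈ XA 𝕜 𝒜 := by
  simpa using indLinf_finset_mem_XA (𝕜 := 𝕜) (𝒜 := 𝒜) hF.toFinset

lemma mul_indLinf_mem_XA_of_generators {S : Set ℕ}
    (hS : ∀ A ∈ 𝒜, indLinf 𝕜 (A ∩ S) ∈ XA 𝕜 𝒜) {f : lp (fun _ : ℕ => 𝕜) ∞}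
    (hf : f ∈ XA 𝕜 𝒜) : f * indLinf 𝕜 S ∈ XA 𝕜 𝒜 := by
  have hle : XA 𝕜 𝒜 ≤ (XA 𝕜 𝒜).comap (LinearMap.mulRight 𝕜 (indLinf 𝕜 S)) := by
    refine XA_le_of_isClosed ?_ (fun A hA => ?_) fun n => ?_
    · exact (Submodule.isClosed_topologicalClosure _).preimage
        (continuous_id.mul continuous_const)
    · simpa [indLinf_mul] using hS A hA
    · simpa [indLinf_mul] using
        indLinf_mem_XA_of_finite ((Set.finite_singleton n).inter_of_left S)
  exact hle hf

lemma mul_indLinf_compl (f : lp (fun _ : ℕ => 𝕜) ∞) (S : Set ℕ) :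
    f * indLinf 𝕜 Sᶜ = f - f * indLinf 𝕜 S := by
  ext n
  rw [lp.coeFn_sub, Pi.sub_apply, mul_indLinf_apply, mul_indLinf_apply]
  by_cases hS : n ∈ S <;> simp [hS]

lemma mul_indLinf_finset_mem_XA (F : Finset ℕ) {f : lp (fun _ : ℕ => 𝕜) ∞}
    (hf : f ∈ XA 𝕜 𝒜) : f * indLinf 𝕜 (F : Set ℕ) ∈ XA 𝕜 𝒜 :=
  mul_indLinf_mem_XA_of_generators
    (fun A _ => indLinf_mem_XA_of_finite (F.finite_toSet.inter_of_right A)) hf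

/-- The union of a finite set of integers with finitely many members of a family. -/
def finUnion (𝓔 : Finset (Set ℕ)) (H : Finset ℕ) : Set ℕ := {n | n ∈ H ∨ ∃ A ∈ 𝓔, n ∈ A}

lemma mul_indLinf_finUnion_mem_XA
    (h_ad : ∀ A ∈ 𝒜, ∀ A' ∈ 𝒜, A ≠ A' → (A ∩ A').Finite) (𝓔 : Finset (Set ℕ))
    (h𝓔 : ∀ A ∈ 𝓔, A ∈ 𝒜) (H : Finset ℕ) {f : lp (fun _ : ℕ => 𝕜) ∞} (hf : f ∈ XA 𝕜 𝒜) :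
    f * indLinf 𝕜 (finUnion 𝓔 H) ∈ XA 𝕜 𝒜 := by
  refine mul_indLinf_mem_XA_of_generators (fun B hB => ?_) hf
  by_cases hB𝓔 : B ∈ 𝓔
  · have : B ∩ finUnion 𝓔 H = B := Set.inter_eq_left.2 fun n hn => Or.inr ⟨B, hB𝓔, hn⟩
    rw [this]
    exact indLinf_mem_XA hB
  · refine indLinf_mem_XA_of_finite (Set.Finite.subset (H.finite_toSet.union
      (𝓔.finite_toSet.biUnion fun A hA => h_ad B hB A (h𝓔 A hA) ?_)) ?_)
    · rintro rfl
      exact hB𝓔 hA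
    · rintro n ⟨hn, h | ⟨A, hA, h⟩⟩
      · exact Or.inl h
      · exact Or.inr (Set.mem_biUnion hA ⟨hn, h⟩)

lemma indLinf_diff_mem_XA {A : Set ℕ} (hA : A ∈ 𝒜) (H : Finset ℕ) :
    indLinf 𝕜 (A \ H) ∈ XA 𝕜 𝒜 := by
  rw [Set.sdiff_eq, ← indLinf_mul, mul_indLinf_compl]
  exact sub_mem (indLinf_mem_XA hA) (mul_indLinf_finset_mem_XA H (indLinf_mem_XA hA))

/-- The finite-rank operator replacing a sequence, off the finite set `H`, by its limits along
the members of `𝓔` and by zero elsewhere. -/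
noncomputable def finProj (𝕜 : Type*) [RCLike 𝕜] (𝓔 : Finset (Set ℕ)) (H : Finset ℕ) :
    lp (fun _ : ℕ => 𝕜) ∞ →L[𝕜] lp (fun _ : ℕ => 𝕜) ∞ :=
  ∑ A ∈ 𝓔, (endEval 𝕜 A).smulRight (indLinf 𝕜 (A \ H)) +
    ∑ n ∈ H, (ultraLim 𝕜 (pure n)).smulRight (indLinf 𝕜 {n})

lemma finProj_eq (𝓔 : Finset (Set ℕ)) (H : Finset ℕ) (f : lp (fun _ : ℕ => 𝕜) ∞) :
    finProj 𝕜 𝓔 H f = ∑ A ∈ 𝓔, endEval 𝕜 A f • indLinf 𝕜 (A \ H) +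
      ∑ n ∈ H, (f : ∀ _ : ℕ, 𝕜) n • indLinf 𝕜 {n} := by
  simp [finProj, ultraLim_pure]

lemma finProj_apply (𝓔 : Finset (Set ℕ)) (H : Finset ℕ) (f : lp (fun _ : ℕ => 𝕜) ∞) (n : ℕ) :
    (finProj 𝕜 𝓔 H f : ∀ _ : ℕ, 𝕜) n =
      ∑ A ∈ 𝓔, endEval 𝕜 A f * (A \ H : Set ℕ).indicator (fun _ => (1 : 𝕜)) n +
      ∑ m ∈ H, (f : ∀ _ : ℕ, 𝕜) m * Set.indicator {m} (fun _ => (1 : 𝕜)) n := by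
  rw [finProj_eq, lp.coeFn_add, Pi.add_apply, lp.coeFn_sum, lp.coeFn_sum, Finset.sum_apply,
    Finset.sum_apply]
  rfl

lemma finProj_apply_of_mem (𝓔 : Finset (Set ℕ)) {H : Finset ℕ} (f : lp (fun _ : ℕ => 𝕜) ∞)
    {n : ℕ} (hn : n ∈ H) : (finProj 𝕜 𝓔 H f : ∀ _ : ℕ, 𝕜) n = (f : ∀ _ : ℕ, 𝕜) n := by
  rw [finProj_apply, Finset.sum_eq_zero fun A _ => by simp [hn], Finset.sum_eq_single n]
  · simp
  · intro m _ hmn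
    simp [hmn.symm]
  · exact fun h => absurd hn h

lemma finProj_apply_of_forall_notMem {𝓔 : Finset (Set ℕ)} {H : Finset ℕ}
    (f : lp (fun _ : ℕ => 𝕜) ∞) {n : ℕ} (hn : n ∉ H) (h : ∀ A ∈ 𝓔, n ∉ A) :
    (finProj 𝕜 𝓔 H f : ∀ _ : ℕ, 𝕜) n = 0 := by
  rw [finProj_apply, Finset.sum_eq_zero fun A hA => by simp [h A hA],
    Finset.sum_eq_zero, add_zero]
  intro m hm
  have : n ≠ m := fun h => hn (h ▸ hm)
  simp [this]

lemma finProj_apply_of_mem_of_notMem {𝓔 : Finset (Set ℕ)} {H : Finset ℕ}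
    (hsep : ∀ A ∈ 𝓔, ∀ B ∈ 𝓔, A ≠ B → A ∩ B ⊆ H) (f : lp (fun _ : ℕ => 𝕜) ∞) {n : ℕ}
    (hn : n ∉ H) {A : Set ℕ} (hA : A ∈ 𝓔) (hnA : n ∈ A) :
    (finProj 𝕜 𝓔 H f : ∀ _ : ℕ, 𝕜) n = endEval 𝕜 A f := by
  rw [finProj_apply, Finset.sum_eq_single A, Finset.sum_eq_zero, add_zero]
  · simp [hn, hnA]
  · intro m hm
    have : n ≠ m := fun h => hn (h ▸ hm)
    simp [this]
  · intro B hB hBA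
    have : n ∉ B := fun h => hn (hsep A hA B hB hBA.symm ⟨hnA, h⟩)
    simp [this]
  · exact fun h => absurd hA h

lemma norm_sub_finProj_le {𝓔 : Finset (Set ℕ)} {H : Finset ℕ}
    (hsep : ∀ A ∈ 𝓔, ∀ B ∈ 𝓔, A ≠ B → A ∩ B ⊆ H) (f : lp (fun _ : ℕ => 𝕜) ∞) :
    ‖f - finProj 𝕜 𝓔 H f‖ ≤ 2 * ‖f‖ := by
  refine lp.norm_le_of_forall_le (by positivity) fun n => ?_
  have hn := lp.norm_apply_le_norm ENNReal.top_ne_zero f n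
  have h0 := norm_nonneg f
  rw [lp.coeFn_sub, Pi.sub_apply]
  by_cases hH : n ∈ H
  · simp [finProj_apply_of_mem 𝓔 f hH]
  by_cases hA : ∃ A ∈ 𝓔, n ∈ A
  · obtain ⟨A, hA, hnA⟩ := hA
    rw [finProj_apply_of_mem_of_notMem hsep f hH hA hnA]
    linarith [norm_sub_le ((f : ∀ _ : ℕ, 𝕜) n) (endEval 𝕜 A f), norm_endEval_apply_le A f]
  · push Not at hA
    rw [finProj_apply_of_forall_notMem f hH hA, sub_zero]
    linarith

lemma finProj_mem_XA {𝓔 : Finset (Set ℕ)} (h𝓔 : ∀ A ∈ 𝓔, A ∈ 𝒜) (H : Finset ℕ)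
    (f : lp (fun _ : ℕ => 𝕜) ∞) : finProj 𝕜 𝓔 H f ∈ XA 𝕜 𝒜 := by
  rw [finProj_eq]
  exact add_mem
    (Submodule.sum_mem _ fun A hA => Submodule.smul_mem _ _ (indLinf_diff_mem_XA (h𝓔 A hA) H))
    (Submodule.sum_mem _ fun n _ => Submodule.smul_mem _ _ (indLinf_singleton_mem_XA n))

lemma isCompactOperator_finProj (𝓔 : Finset (Set ℕ)) (H : Finset ℕ) :
    IsCompactOperator (finProj 𝕜 𝓔 H) := by
  have key (φ : lp (fun _ : ℕ => 𝕜) ∞ →L[𝕜] 𝕜) (x : lp (fun _ : ℕ => 𝕜) ∞) :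
      φ.smulRight x ∈ compactOperator (RingHom.id 𝕜) (lp (fun _ : ℕ => 𝕜) ∞)
        (lp (fun _ : ℕ => 𝕜) ∞) :=
    (isCompactOperator_of_locallyCompactSpace_dom φ).clm_comp
      (ContinuousLinearMap.toSpanSingleton 𝕜 x)
  exact add_mem (Submodule.sum_mem _ fun A _ => key _ _) (Submodule.sum_mem _ fun n _ => key _ _)

lemma exists_lt_norm_apply_sub_finProj
    (T : XA 𝕜 𝒜 →L[𝕜] XA 𝕜 𝒜)
    (hTe : Metric.infDist T {S : XA 𝕜 𝒜 →L[𝕜] XA 𝕜 𝒜 | IsCompactOperator ⇑S} = 1)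
    {𝓔 : Finset (Set ℕ)} (h𝓔 : ∀ A ∈ 𝓔, A ∈ 𝒜) (H : Finset ℕ) {r : ℝ} (hr0 : 0 ≤ r)
    (hr : r < 1) : ∃ x : XA 𝕜 𝒜, ∃ n, r * ‖x‖ <
      ‖((T x : lp (fun _ : ℕ => 𝕜) ∞) : ∀ _ : ℕ, 𝕜) n - (finProj 𝕜 𝓔 H (T x) : ∀ _ : ℕ, 𝕜) n‖ := by
  let S : XA 𝕜 𝒜 →L[𝕜] XA 𝕜 𝒜 :=
    ((finProj 𝕜 𝓔 H).comp ((XA 𝕜 𝒜).subtypeL.comp T)).codRestrict (XA 𝕜 𝒜)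
      fun x => finProj_mem_XA h𝓔 H _
  have hS : IsCompactOperator S :=
    ((isCompactOperator_finProj 𝓔 H).comp_clm ((XA 𝕜 𝒜).subtypeL.comp T)).codRestrict
      (V := XA 𝕜 𝒜) (fun x => finProj_mem_XA h𝓔 H _) (Submodule.isClosed_topologicalClosure _)
  have h1 : 1 ≤ ‖T - S‖ := by
    have h := Metric.infDist_le_dist_of_mem (x := T)
      (show S ∈ {S : XA 𝕜 𝒜 →L[𝕜] XA 𝕜 𝒜 | IsCompactOperator ⇑S} from hS)
    rw [hTe] at h
    exact h.trans_eq (dist_eq_norm T S)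
  by_contra! hcon
  refine absurd (h1.trans (ContinuousLinearMap.opNorm_le_bound _ hr0 fun x => ?_)) hr.not_ge
  exact lp.norm_le_of_forall_le (by positivity) (hcon x)

lemma exists_notMem_lt_opNorm
    (h_ad : ∀ A ∈ 𝒜, ∀ A' ∈ 𝒜, A ≠ A' → (A ∩ A').Finite)
    (T : XA 𝕜 𝒜 →L[𝕜] XA 𝕜 𝒜)
    (hTe : Metric.infDist T {S : XA 𝕜 𝒜 →L[𝕜] XA 𝕜 𝒜 | IsCompactOperator ⇑S} = 1)
    {r : ℝ} (hr0 : 0 ≤ r) (hr : r < 1)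
    (hend : ∀ A ∈ 𝒜, ∀ᶠ n in endFilter A, ∀ x : XA 𝕜 𝒜,
      ‖((T x : lp (fun _ : ℕ => 𝕜) ∞) : ∀ _ : ℕ, 𝕜) n - endEval 𝕜 A (T x)‖ ≤ r * ‖x‖)
    {𝓔 : Finset (Set ℕ)} (h𝓔 : ∀ A ∈ 𝓔, A ∈ 𝒜) (N : ℕ) :
    ∃ n, N ≤ n ∧ (∀ A ∈ 𝓔, n ∉ A) ∧ ∃ x : XA 𝕜 𝒜, ‖x‖ ≤ 1 ∧
      r < ‖((T x : lp (fun _ : ℕ => 𝕜) ∞) : ∀ _ : ℕ, 𝕜) n‖ := by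
  classical
  have hfin (A : Set ℕ) (hA : A ∈ 𝒜) : {n | n ∈ A ∧ ¬∀ x : XA 𝕜 𝒜,
      ‖((T x : lp (fun _ : ℕ => 𝕜) ∞) : ∀ _ : ℕ, 𝕜) n - endEval 𝕜 A (T x)‖ ≤
        r * ‖x‖}.Finite := by
    have h := hend A hA
    rw [endFilter, eventually_inf_principal, eventually_cofinite] at h
    simpa using h
  have hbad : (⋃ A ∈ 𝓔, {n | n ∈ A ∧ ¬∀ x : XA 𝕜 𝒜,
      ‖((T x : lp (fun _ : ℕ => 𝕜) ∞) : ∀ _ : ℕ, 𝕜) n - endEval 𝕜 A (T x)‖ ≤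
        r * ‖x‖}).Finite := 𝓔.finite_toSet.biUnion fun A hA => hfin A (h𝓔 A hA)
  have hsep : (⋃ A ∈ 𝓔, ⋃ B ∈ 𝓔.erase A, A ∩ B).Finite :=
    𝓔.finite_toSet.biUnion fun A hA => (𝓔.erase A).finite_toSet.biUnion fun B hB =>
      h_ad A (h𝓔 A hA) B (h𝓔 B (Finset.mem_of_mem_erase hB)) (Finset.ne_of_mem_erase hB).symm
  let H : Finset ℕ := hbad.toFinset ∪ hsep.toFinset ∪ Finset.range N
  have hsepH : ∀ A ∈ 𝓔, ∀ B ∈ 𝓔, A ≠ B → A ∩ B ⊆ H := by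
    intro A hA B hB hAB n hn
    have : n ∈ ⋃ A ∈ 𝓔, ⋃ B ∈ 𝓔.erase A, A ∩ B :=
      Set.mem_biUnion hA (Set.mem_biUnion (Finset.mem_erase.2 ⟨hAB.symm, hB⟩) hn)
    have h2 : n ∈ hsep.toFinset := hsep.mem_toFinset.2 this
    exact Finset.mem_coe.2 (Finset.mem_union_left _ (Finset.mem_union_right _ h2))
  obtain ⟨x, n, hx⟩ := exists_lt_norm_apply_sub_finProj T hTe h𝓔 H hr0 hr
  have hnH : n ∉ H := by
    intro hn
    rw [finProj_apply_of_mem 𝓔 _ hn, sub_self, norm_zero] at hx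
    exact absurd hx (not_lt.2 (by positivity))
  have hnE : ∀ A ∈ 𝓔, n ∉ A := by
    intro A hA hnA
    rw [finProj_apply_of_mem_of_notMem hsepH _ hnH hA hnA] at hx
    refine hnH (Finset.mem_union_left _ (Finset.mem_union_left _ (hbad.mem_toFinset.2 ?_)))
    exact Set.mem_biUnion hA ⟨hnA, fun h => absurd (h x) hx.not_ge⟩
  rw [finProj_apply_of_forall_notMem _ hnH hnE, sub_zero] at hx
  have hx0 : 0 < ‖x‖ := by
    rw [norm_pos_iff]
    rintro rfl
    simp at hx
  refine ⟨n, ?_, hnE, ((‖x‖⁻¹ : ℝ) : 𝕜) • x, ?_, ?_⟩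
  · by_contra! hlt
    exact hnH (Finset.mem_union_right _ (Finset.mem_range.2 hlt))
  · rw [norm_smul, RCLike.norm_ofReal, abs_of_pos (inv_pos.2 hx0), inv_mul_cancel₀ hx0.ne']
  · rw [map_smul, Submodule.coe_smul, lp.coeFn_smul, Pi.smul_apply, norm_smul,
      RCLike.norm_ofReal, abs_of_pos (inv_pos.2 hx0), lt_inv_mul_iff₀ hx0, mul_comm]
    exact hx

/-- A weak-star null sequence of functionals of norm at most two whose images under the adjoint
of `T` have norm larger than `r`. -/
lemma exists_weakStarNull_lt_norm_comp (h_inf : ∀ A ∈ 𝒜, A.Infinite)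
    (h_ad : ∀ A ∈ 𝒜, ∀ A' ∈ 𝒜, A ≠ A' → (A ∩ A').Finite)
    (T : XA 𝕜 𝒜 →L[𝕜] XA 𝕜 𝒜)
    (hTe : Metric.infDist T {S : XA 𝕜 𝒜 →L[𝕜] XA 𝕜 𝒜 | IsCompactOperator ⇑S} = 1)
    {r : ℝ} (hr0 : 0 ≤ r) (hr : r < 1) :
    ∃ φ : ℕ → XA 𝕜 𝒜 →L[𝕜] 𝕜, (∀ k, ‖φ k‖ ≤ 2) ∧
      (∀ x, Tendsto (fun k => φ k x) atTop (𝓝 0)) ∧ ∀ k, r < ‖φ k ∘L T‖ := by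
  classical
  have hdiff (A : Set ℕ) (n : ℕ) :
      ‖(ultraLim 𝕜 (pure n) - endEval 𝕜 A) ∘L (XA 𝕜 𝒜).subtypeL‖ ≤ 2 := by
    refine ContinuousLinearMap.opNorm_le_bound _ zero_le_two fun x => ?_
    have h1 := norm_ultraLim_apply_le (pure n) (x : lp (fun _ : ℕ => 𝕜) ∞)
    have h2 := norm_endEval_apply_le A (x : lp (fun _ : ℕ => 𝕜) ∞)
    have h3 := norm_sub_le (ultraLim 𝕜 (pure n) (x : lp (fun _ : ℕ => 𝕜) ∞))
      (endEval 𝕜 A (x : lp (fun _ : ℕ => 𝕜) ∞))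
    have h4 : ‖(x : lp (fun _ : ℕ => 𝕜) ∞)‖ = ‖x‖ := rfl
    simp only [ContinuousLinearMap.comp_apply, sub_apply, Submodule.subtypeL_apply]
    linarith
  have hnull {A : Set ℕ} (hA : A ∈ 𝒜) {n : ℕ → ℕ} (hn : Tendsto n atTop (endFilter A))
      (x : XA 𝕜 𝒜) : Tendsto (fun k => ((ultraLim 𝕜 (pure (n k)) - endEval 𝕜 A) ∘L
        (XA 𝕜 𝒜).subtypeL) x) atTop (𝓝 0) := by
    have h := ((tendsto_endEval h_inf h_ad hA x.2).comp hn).sub_const (endEval 𝕜 A x)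
    rw [sub_self] at h
    refine h.congr fun k => ?_
    simp [ultraLim_pure]
  have hopNorm {ψ : XA 𝕜 𝒜 →L[𝕜] 𝕜} (x : XA 𝕜 𝒜) (hx : ‖x‖ ≤ 1) (h : r < ‖ψ x‖) : r < ‖ψ‖ :=
    h.trans_le (by simpa using ψ.le_opNorm_of_le hx)
  by_cases hend : ∀ A ∈ 𝒜, ∀ᶠ n in endFilter A, ∀ x : XA 𝕜 𝒜,
      ‖((T x : lp (fun _ : ℕ => 𝕜) ∞) : ∀ _ : ℕ, 𝕜) n - endEval 𝕜 A (T x)‖ ≤ r * ‖x‖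
  · have hlarge (n : ℕ) : ∃ y : XA 𝕜 𝒜, ‖y‖ ≤ 1 ∧ ((∃ x : XA 𝕜 𝒜, ‖x‖ ≤ 1 ∧
        r < ‖((T x : lp (fun _ : ℕ => 𝕜) ∞) : ∀ _ : ℕ, 𝕜) n‖) →
        r < ‖((T y : lp (fun _ : ℕ => 𝕜) ∞) : ∀ _ : ℕ, 𝕜) n‖) := by
      by_cases h : ∃ x : XA 𝕜 𝒜, ‖x‖ ≤ 1 ∧
        r < ‖((T x : lp (fun _ : ℕ => 𝕜) ∞) : ∀ _ : ℕ, 𝕜) n‖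
      · exact h.imp fun y hy => ⟨hy.1, fun _ => hy.2⟩
      · exact ⟨0, by simp, fun h' => absurd h' h⟩
    choose y hy1 hy using hlarge
    have hcount : (⋃ n, {A | A ∈ 𝒜 ∧ endEval 𝕜 A (T (y n)) ≠ 0}).Countable :=
      Set.countable_iUnion fun n => countable_endEval_ne_zero h_inf h_ad (T (y n)).2
    obtain ⟨g, hg⟩ := Set.countable_iff_exists_subset_range.1 hcount
    have hsel (k : ℕ) := exists_notMem_lt_opNorm h_ad T hTe hr0 hr hend
      (𝓔 := ((Finset.range k).image g).filter (· ∈ 𝒜)) (fun A hA => (Finset.mem_filter.1 hA).2) k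
    choose n hkn hn hx using hsel
    have hn_top : Tendsto n atTop atTop := tendsto_atTop_mono hkn tendsto_id
    by_cases hfin : ∀ A ∈ 𝒜, ∀ᶠ k in atTop, n k ∉ A
    · refine ⟨fun k => ultraLim 𝕜 (pure (n k)) ∘L (XA 𝕜 𝒜).subtypeL, fun k => ?_, fun x => ?_,
        fun k => hopNorm (y (n k)) (hy1 _) ?_⟩
      · refine ContinuousLinearMap.opNorm_le_bound _ zero_le_two fun x => ?_
        have h1 := norm_ultraLim_apply_le (pure (n k)) (x : lp (fun _ : ℕ => 𝕜) ∞)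
        have h2 := norm_nonneg x
        have h3 : ‖(x : lp (fun _ : ℕ => 𝕜) ∞)‖ = ‖x‖ := rfl
        simp only [ContinuousLinearMap.comp_apply, Submodule.subtypeL_apply]
        linarith
      · have h := (tendsto_zero_of_mem_XA (l := map n atTop) (Nat.cofinite_eq_atTop ▸ hn_top)
          (fun A hA => hfin A hA) x.2)
        refine (tendsto_map'_iff.1 h).congr fun k => ?_
        simp [ultraLim_pure]
      · simpa [ultraLim_pure] using hy (n k) (hx k)
    · push Not at hfin
      obtain ⟨A, hA, hfreq⟩ := hfin
      obtain ⟨s, hs, hsA⟩ := extraction_of_frequently_atTop hfreq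
      have hA0 (m : ℕ) : endEval 𝕜 A (T (y m)) = 0 := by
        by_contra h
        obtain ⟨j, rfl⟩ := hg (Set.mem_iUnion.2 ⟨m, hA, h⟩)
        refine hn (s (j + 1)) (g j) (Finset.mem_filter.2 ⟨Finset.mem_image_of_mem _
          (Finset.mem_range.2 ((Nat.lt_succ_self j).trans_le hs.le_apply)), hA⟩) (hsA _)
      refine ⟨fun k => (ultraLim 𝕜 (pure (n (s k))) - endEval 𝕜 A) ∘L (XA 𝕜 𝒜).subtypeL,
        fun k => hdiff _ _, hnull hA ?_, fun k => hopNorm (y (n (s k))) (hy1 _) ?_⟩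
      · rw [endFilter, Nat.cofinite_eq_atTop, tendsto_inf, tendsto_principal]
        exact ⟨hn_top.comp hs.tendsto_atTop, Eventually.of_forall hsA⟩
      · simpa [ultraLim_pure, hA0] using hy _ (hx (s k))
  · push Not at hend
    obtain ⟨A, hA, hfreq⟩ := hend
    have hA_eq : endFilter A = atTop ⊓ 𝓟 A := by rw [endFilter, Nat.cofinite_eq_atTop]
    rw [hA_eq] at hfreq
    obtain ⟨n, hn, hx⟩ := exists_seq_forall_of_frequently hfreq
    refine ⟨fun k => (ultraLim 𝕜 (pure (n k)) - endEval 𝕜 A) ∘L (XA 𝕜 𝒜).subtypeL,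
      fun k => hdiff _ _, hnull hA (hA_eq ▸ hn), fun k => ?_⟩
    obtain ⟨x, hx⟩ := hx k
    by_contra! h
    refine absurd (hx.trans_le ?_) (lt_irrefl _)
    refine le_trans (le_of_eq ?_) (ContinuousLinearMap.le_of_opNorm_le _ h x)
    simp [ultraLim_pure]

/-- The sequence `f` vanishes outside the set `S`. -/
def VanishesOff (f : lp (fun _ : ℕ => 𝕜) ∞) (S : Set ℕ) : Prop :=
  ∀ n, n ∉ S → (f : ∀ _ : ℕ, 𝕜) n = 0

lemma VanishesOff.mono {f : lp (fun _ : ℕ => 𝕜) ∞} {S S' : Set ℕ} (hf : VanishesOff f S)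
    (h : S ⊆ S') : VanishesOff f S' :=
  fun n hn => hf n fun hS => hn (h hS)

lemma VanishesOff.add {f g : lp (fun _ : ℕ => 𝕜) ∞} {S : Set ℕ} (hf : VanishesOff f S)
    (hg : VanishesOff g S) : VanishesOff (f + g) S := fun n hn => by
  rw [lp.coeFn_add, Pi.add_apply, hf n hn, hg n hn, add_zero]

lemma VanishesOff.smul {f : lp (fun _ : ℕ => 𝕜) ∞} {S : Set ℕ} (c : 𝕜) (hf : VanishesOff f S) :
    VanishesOff (c • f) S := fun n hn => by
  rw [lp.coeFn_smul, Pi.smul_apply, hf n hn, smul_zero]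

lemma VanishesOff.mul_right {f : lp (fun _ : ℕ => 𝕜) ∞} {S : Set ℕ} (hf : VanishesOff f S)
    (g : lp (fun _ : ℕ => 𝕜) ∞) : VanishesOff (f * g) S := fun n hn => by
  rw [lp.infty_coeFn_mul, Pi.mul_apply, hf n hn, zero_mul]

lemma vanishesOff_mul_indLinf (f : lp (fun _ : ℕ => 𝕜) ∞) (S : Set ℕ) :
    VanishesOff (f * indLinf 𝕜 S) S := fun n hn => by
  rw [mul_indLinf_apply, Set.indicator_of_notMem hn]

lemma norm_mul_indLinf_le (f : lp (fun _ : ℕ => 𝕜) ∞) (S : Set ℕ) :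
    ‖f * indLinf 𝕜 S‖ ≤ ‖f‖ := by
  refine lp.norm_le_of_forall_le (norm_nonneg _) fun n => ?_
  rw [mul_indLinf_apply]
  exact (norm_indicator_le_norm_self _ _).trans (lp.norm_apply_le_norm ENNReal.top_ne_zero f n)

lemma finUnion_mono {𝓔 𝓔' : Finset (Set ℕ)} {H H' : Finset ℕ} (h : 𝓔 ⊆ 𝓔') (h' : H ⊆ H') :
    finUnion 𝓔 H ⊆ finUnion 𝓔' H' := by
  rintro n (hn | ⟨A, hA, hn⟩)
  exacts [Or.inl (h' hn), Or.inr ⟨A, h hA, hn⟩]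

lemma finite_finUnion_inter (h_ad : ∀ A ∈ 𝒜, ∀ A' ∈ 𝒜, A ≠ A' → (A ∩ A').Finite)
    {𝓔 𝓔' : Finset (Set ℕ)} (h𝓔 : ∀ A ∈ 𝓔, A ∈ 𝒜) (h𝓔' : ∀ A ∈ 𝓔', A ∈ 𝒜 ∧ A ∉ 𝓔)
    (H H' : Finset ℕ) : (finUnion 𝓔 H ∩ finUnion 𝓔' H').Finite := by
  have h : (⋃ A ∈ 𝓔, ⋃ B ∈ 𝓔', A ∩ B).Finite :=
    𝓔.finite_toSet.biUnion fun A hA => 𝓔'.finite_toSet.biUnion fun B hB =>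
      h_ad A (h𝓔 A hA) B (h𝓔' B hB).1 fun hAB => (h𝓔' B hB).2 (hAB ▸ hA)
  refine ((H.finite_toSet.union H'.finite_toSet).union h).subset ?_
  rintro n ⟨hn | ⟨A, hA, hnA⟩, hn' | ⟨B, hB, hnB⟩⟩
  · exact Or.inl (Or.inl hn)
  · exact Or.inl (Or.inl hn)
  · exact Or.inl (Or.inr hn')
  · exact Or.inr (Set.mem_biUnion hA (Set.mem_biUnion hB ⟨hnA, hnB⟩))

lemma eventually_norm_apply_sum_le {E ι : Type*} [NormedAddCommGroup E] [NormedSpace 𝕜 E]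
    {ψ : ℕ → E →L[𝕜] 𝕜} (hψ : ∀ x, Tendsto (fun k => ψ k x) atTop (𝓝 0)) (s : Finset ι)
    (e : ι → E) {ε : ℝ} (hε : 0 < ε) :
    ∀ᶠ k in atTop, ∀ c : ι → 𝕜, (∀ i ∈ s, ‖c i‖ ≤ 1) → ‖ψ k (∑ i ∈ s, c i • e i)‖ ≤ ε := by
  have h : Tendsto (fun k => ∑ i ∈ s, ‖ψ k (e i)‖) atTop (𝓝 0) := by
    simpa using tendsto_finsetSum s fun i _ => (hψ (e i)).norm
  filter_upwards [h.eventually_le_const hε] with k hk c hc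
  rw [map_sum]
  refine ((norm_sum_le _ _).trans (Finset.sum_le_sum fun i hi => ?_)).trans hk
  rw [map_smul, norm_smul]
  exact mul_le_of_le_one_left (norm_nonneg _) (hc i hi)

lemma eventually_norm_apply_le_of_vanishesOff_finset {ψ : ℕ → XA 𝕜 𝒜 →L[𝕜] 𝕜}
    (hψ : ∀ x, Tendsto (fun k => ψ k x) atTop (𝓝 0)) (F : Finset ℕ) {ε : ℝ} (hε : 0 < ε) :
    ∀ᶠ k in atTop, ∀ x : XA 𝕜 𝒜, ‖x‖ ≤ 1 →
      VanishesOff (x : lp (fun _ : ℕ => 𝕜) ∞) (F : Set ℕ) → ‖ψ k x‖ ≤ ε := by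
  filter_upwards [eventually_norm_apply_sum_le hψ F
    (fun n => (⟨indLinf 𝕜 {n}, indLinf_singleton_mem_XA n⟩ : XA 𝕜 𝒜)) hε] with k hk x hx hxF
  have hx_eq : x = ∑ n ∈ F, ((x : lp (fun _ : ℕ => 𝕜) ∞) : ∀ _ : ℕ, 𝕜) n •
      (⟨indLinf 𝕜 {n}, indLinf_singleton_mem_XA n⟩ : XA 𝕜 𝒜) := by
    ext m
    rw [Submodule.coe_sum, lp.coeFn_sum, Finset.sum_apply]
    by_cases hm : m ∈ F
    · simp [indLinf_apply, Set.indicator_apply, hm]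
    · simpa [indLinf_apply, Set.indicator_apply, hm] using hxF m hm
  rw [hx_eq]
  exact hk _ fun n _ => (lp.norm_apply_le_norm ENNReal.top_ne_zero _ n).trans hx

lemma eventually_norm_apply_finProj_le {ψ : ℕ → XA 𝕜 𝒜 →L[𝕜] 𝕜}
    (hψ : ∀ x, Tendsto (fun k => ψ k x) atTop (𝓝 0)) {𝓔 : Finset (Set ℕ)}
    (h𝓔 : ∀ A ∈ 𝓔, A ∈ 𝒜) (H : Finset ℕ) {ε : ℝ} (hε : 0 < ε) :
    ∀ᶠ k in atTop, ∀ f : lp (fun _ : ℕ => 𝕜) ∞, ‖f‖ ≤ 1 →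
      ‖ψ k ⟨finProj 𝕜 𝓔 H f, finProj_mem_XA h𝓔 H f⟩‖ ≤ ε := by
  filter_upwards [eventually_norm_apply_sum_le hψ 𝓔.attach
    (fun A => (⟨indLinf 𝕜 (A \ H), indLinf_diff_mem_XA (h𝓔 A A.2) H⟩ : XA 𝕜 𝒜)) (half_pos hε),
    eventually_norm_apply_sum_le hψ H
    (fun n => (⟨indLinf 𝕜 {n}, indLinf_singleton_mem_XA n⟩ : XA 𝕜 𝒜)) (half_pos hε)]
    with k h1 h2 f hf
  have heq : (⟨finProj 𝕜 𝓔 H f, finProj_mem_XA h𝓔 H f⟩ : XA 𝕜 𝒜) =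
      ∑ A ∈ 𝓔.attach, endEval 𝕜 A f •
        (⟨indLinf 𝕜 (A \ H), indLinf_diff_mem_XA (h𝓔 A A.2) H⟩ : XA 𝕜 𝒜) +
      ∑ n ∈ H, (f : ∀ _ : ℕ, 𝕜) n •
        (⟨indLinf 𝕜 {n}, indLinf_singleton_mem_XA n⟩ : XA 𝕜 𝒜) := by
    refine Subtype.ext ((finProj_eq 𝓔 H f).trans ?_)
    rw [Submodule.coe_add, Submodule.coe_sum, Submodule.coe_sum,
      ← Finset.sum_attach 𝓔]
    rfl
  rw [heq, map_add]
  refine (norm_add_le _ _).trans ((add_le_add (h1 _ fun A _ => ?_) (h2 _ fun n _ => ?_)).trans_eq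
    (add_halves ε))
  · exact (norm_endEval_apply_le _ f).trans hf
  · exact (lp.norm_apply_le_norm ENNReal.top_ne_zero f n).trans hf

/-- Only finitely many members of `𝒜` matter for a bounded weak-star null sequence of functionals,
up to a small error. -/
lemma exists_finset_frequently_re_le
    (h_ad : ∀ A ∈ 𝒜, ∀ A' ∈ 𝒜, A ≠ A' → (A ∩ A').Finite) {ψ : ℕ → XA 𝕜 𝒜 →L[𝕜] 𝕜} {M : ℝ}
    (hM : ∀ k, ‖ψ k‖ ≤ M) (hψ : ∀ x, Tendsto (fun k => ψ k x) atTop (𝓝 0)) {η : ℝ}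
    (hη : 0 < η) :
    ∃ 𝓔 : Finset (Set ℕ), (∀ A ∈ 𝓔, A ∈ 𝒜) ∧ ∀ (𝓔' : Finset (Set ℕ)) (H : Finset ℕ),
      (∀ A ∈ 𝓔', A ∈ 𝒜 ∧ A ∉ 𝓔) → ∃ᶠ k in atTop, ∀ x : XA 𝕜 𝒜, ‖x‖ ≤ 1 →
        VanishesOff (x : lp (fun _ : ℕ => 𝕜) ∞) (finUnion 𝓔' H) → RCLike.re (ψ k x) ≤ η := by
  classical
  by_contra! hcon
  have hind (r : ℕ) : ∃ (𝓔 : Finset (Set ℕ)) (H : Finset ℕ), (∀ A ∈ 𝓔, A ∈ 𝒜) ∧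
      ∀ᶠ k in atTop, ∃ x : XA 𝕜 𝒜, ‖x‖ ≤ 1 ∧
        VanishesOff (x : lp (fun _ : ℕ => 𝕜) ∞) (finUnion 𝓔 H) ∧
        r * (η / 2) ≤ RCLike.re (ψ k x) := by
    induction r with
    | zero => exact ⟨∅, ∅, by simp, Eventually.of_forall fun k => ⟨0, by simp, fun n _ => rfl,
        by simp⟩⟩
    | succ r ih =>
      obtain ⟨𝓔, H, h𝓔, hx⟩ := ih
      obtain ⟨𝓔', H', h𝓔', hy⟩ := hcon 𝓔 h𝓔
      have hF := finite_finUnion_inter h_ad h𝓔 h𝓔' H H'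
      refine ⟨𝓔 ∪ 𝓔', H ∪ H', fun A hA => (Finset.mem_union.1 hA).elim (h𝓔 A)
        fun h => (h𝓔' A h).1, ?_⟩
      filter_upwards [hx, hy,
        eventually_norm_apply_le_of_vanishesOff_finset hψ hF.toFinset (half_pos hη)] with
        k ⟨x, hx1, hxS, hx⟩ ⟨y, hy1, hyS, hy⟩ hk
      let z : XA 𝕜 𝒜 := ⟨y * indLinf 𝕜 (hF.toFinset : Set ℕ), mul_indLinf_finset_mem_XA _ y.2⟩
      have hz : ‖ψ k z‖ ≤ η / 2 :=
        hk z ((norm_mul_indLinf_le _ _).trans hy1) (vanishesOff_mul_indLinf _ _)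
      have hyz (n : ℕ) : ((y - z : XA 𝕜 𝒜) : lp (fun _ : ℕ => 𝕜) ∞) n =
          (hF.toFinset : Set ℕ)ᶜ.indicator (fun m => (y : lp (fun _ : ℕ => 𝕜) ∞) m) n := by
        rw [← mul_indLinf_apply, mul_indLinf_compl]
        rfl
      have hyzS : VanishesOff ((y - z : XA 𝕜 𝒜) : lp (fun _ : ℕ => 𝕜) ∞) (finUnion 𝓔' H') := by
        intro n hn
        rw [hyz, Set.indicator_apply, hyS n hn, ite_self]
      refine ⟨x + (y - z), ?_, ?_, ?_⟩
      · rw [Submodule.coe_norm, Submodule.coe_add]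
        refine lp.norm_le_of_forall_le zero_le_one fun n => ?_
        rw [lp.coeFn_add, Pi.add_apply]
        by_cases hn : n ∈ finUnion 𝓔 H
        · have h0 : ((y - z : XA 𝕜 𝒜) : lp (fun _ : ℕ => 𝕜) ∞) n = 0 := by
            by_cases hn' : n ∈ finUnion 𝓔' H'
            · rw [hyz, Set.indicator_of_notMem]
              simpa using ⟨hn, hn'⟩
            · exact hyzS n hn'
          rw [h0, add_zero]
          exact (lp.norm_apply_le_norm ENNReal.top_ne_zero _ n).trans hx1
        · rw [hxS n hn, zero_add, hyz]
          exact (norm_indicator_le_norm_self _ _).trans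
            ((lp.norm_apply_le_norm ENNReal.top_ne_zero _ n).trans hy1)
      · exact (hxS.mono (finUnion_mono Finset.subset_union_left Finset.subset_union_left)).add
          (hyzS.mono (finUnion_mono Finset.subset_union_right Finset.subset_union_right))
      · have := (RCLike.re_le_norm _).trans hz
        rw [map_add, map_sub, map_add, map_sub]
        push_cast
        linarith
  obtain ⟨r, hr⟩ := exists_nat_gt (M / (η / 2))
  obtain ⟨𝓔, H, -, hx⟩ := hind r
  obtain ⟨k, x, hx1, -, hx⟩ := hx.exists
  rw [div_lt_iff₀ (half_pos hη)] at hr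
  have h1 := (RCLike.re_le_norm (ψ k x)).trans ((ψ k).le_of_opNorm_le_of_le (hM k) hx1)
  linarith

/-- The difference `g - finProj g` is supported on finitely many further members of `𝒜`
and finitely many points. -/
lemma exists_vanishesOff_sub_finProj (h_inf : ∀ A ∈ 𝒜, A.Infinite)
    (h_ad : ∀ A ∈ 𝒜, ∀ A' ∈ 𝒜, A ≠ A' → (A ∩ A').Finite)
    {𝓔 : Finset (Set ℕ)} (h𝓔 : ∀ A ∈ 𝓔, A ∈ 𝒜) {H : Finset ℕ}
    (hsep : ∀ A ∈ 𝓔, ∀ B ∈ 𝓔, A ≠ B → A ∩ B ⊆ H) {g : lp (fun _ : ℕ => 𝕜) ∞}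
    (hg : g ∈ Submodule.span 𝕜 ((fun A => indLinf 𝕜 A) '' 𝒜 ∪
      Set.range fun n : ℕ => indLinf 𝕜 {n})) :
    ∃ (𝓔' : Finset (Set ℕ)) (H' : Finset ℕ), (∀ A ∈ 𝓔', A ∈ 𝒜 ∧ A ∉ 𝓔) ∧
      VanishesOff (g - finProj 𝕜 𝓔 H g) (finUnion 𝓔' H') := by
  classical
  have hgen {B : Set ℕ} (hB : ∀ A ∈ 𝓔, (A ∩ B).Finite) :
      VanishesOff (indLinf 𝕜 B - finProj 𝕜 𝓔 H (indLinf 𝕜 B)) B := by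
    intro n hn
    rw [lp.coeFn_sub, Pi.sub_apply, sub_eq_zero]
    by_cases hnH : n ∈ H
    · rw [finProj_apply_of_mem _ _ hnH]
    · rw [indLinf_apply, Set.indicator_of_notMem hn]
      by_cases h : ∃ A ∈ 𝓔, n ∈ A
      · obtain ⟨A, hA, hnA⟩ := h
        rw [finProj_apply_of_mem_of_notMem hsep _ hnH hA hnA,
          endEval_indLinf (h_inf A (h𝓔 A hA)) (hB A hA)]
      · push Not at h
        rw [finProj_apply_of_forall_notMem _ hnH h]
  induction hg using Submodule.span_induction with
  | mem g hg =>
    rcases hg with ⟨B, hB, rfl⟩ | ⟨m, rfl⟩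
    · by_cases hB𝓔 : B ∈ 𝓔
      · refine ⟨∅, ∅, by simp, fun n _ => ?_⟩
        rw [lp.coeFn_sub, Pi.sub_apply, sub_eq_zero]
        by_cases hnH : n ∈ H
        · rw [finProj_apply_of_mem _ _ hnH]
        by_cases h : ∃ A ∈ 𝓔, n ∈ A
        · obtain ⟨A, hA, hnA⟩ := h
          rw [finProj_apply_of_mem_of_notMem hsep _ hnH hA hnA, indLinf_apply]
          rcases eq_or_ne A B with rfl | hAB
          · rw [endEval_indLinf_self (h_inf A hB), Set.indicator_of_mem hnA]
          · rw [endEval_indLinf (h_inf A (h𝓔 A hA)) (h_ad A (h𝓔 A hA) B hB hAB),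
              Set.indicator_of_notMem fun hnB => hnH (hsep A hA B hB𝓔 hAB ⟨hnA, hnB⟩)]
        · push Not at h
          rw [finProj_apply_of_forall_notMem _ hnH h, indLinf_apply,
            Set.indicator_of_notMem (h B hB𝓔)]
      · refine ⟨{B}, ∅, by simpa using ⟨hB, hB𝓔⟩, (hgen fun A hA => h_ad A (h𝓔 A hA) B hB
          fun h => hB𝓔 (h ▸ hA)).mono fun n hn => Or.inr ⟨B, by simp, hn⟩⟩
    · exact ⟨∅, {m}, by simp, (hgen fun A _ => (Set.finite_singleton m).inter_of_right A).mono
        fun n hn => Or.inl (by simpa using hn)⟩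
  | zero => exact ⟨∅, ∅, by simp, fun n _ => by simp⟩
  | add f g _ _ hf hg =>
    obtain ⟨𝓔₁, H₁, h₁, hf⟩ := hf
    obtain ⟨𝓔₂, H₂, h₂, hg⟩ := hg
    refine ⟨𝓔₁ ∪ 𝓔₂, H₁ ∪ H₂, fun A hA => (Finset.mem_union.1 hA).elim (h₁ A) (h₂ A), ?_⟩
    rw [map_add, add_sub_add_comm]
    exact (hf.mono (finUnion_mono Finset.subset_union_left Finset.subset_union_left)).add
      (hg.mono (finUnion_mono Finset.subset_union_right Finset.subset_union_right))
  | smul c f _ hf =>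
    obtain ⟨𝓔₁, H₁, h₁, hf⟩ := hf
    refine ⟨𝓔₁, H₁, h₁, ?_⟩
    rw [map_smul, ← smul_sub]
    exact hf.smul c

lemma exists_mem_span_lt_re (ψ : XA 𝕜 𝒜 →L[𝕜] 𝕜) {ρ : ℝ} (hρ : ρ < ‖ψ‖) :
    ∃ x : XA 𝕜 𝒜, (x : lp (fun _ : ℕ => 𝕜) ∞) ∈ Submodule.span 𝕜 ((fun A => indLinf 𝕜 A) '' 𝒜 ∪
      Set.range fun n : ℕ => indLinf 𝕜 {n}) ∧ ‖x‖ ≤ 1 ∧ ρ < RCLike.re (ψ x) := by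
  obtain ⟨y, hy1, hy⟩ := ψ.exists_lt_apply_of_lt_opNorm hρ
  obtain ⟨c, hc1, hc⟩ := RCLike.exists_norm_eq_mul_self (ψ y)
  have hopen : IsOpen {x : XA 𝕜 𝒜 | ‖x‖ < 1 ∧ ρ < RCLike.re (ψ x)} :=
    (isOpen_lt continuous_norm continuous_const).inter
      (isOpen_lt continuous_const (RCLike.continuous_re.comp ψ.continuous))
  obtain ⟨O, hO, hO_eq⟩ := isOpen_induced_iff.1 hopen
  have hyO : ((c • y : XA 𝕜 𝒜) : lp (fun _ : ℕ => 𝕜) ∞) ∈ O := by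
    have : c • y ∈ {x : XA 𝕜 𝒜 | ‖x‖ < 1 ∧ ρ < RCLike.re (ψ x)} := by
      refine ⟨by rwa [norm_smul, hc1, one_mul], ?_⟩
      rw [map_smul, smul_eq_mul, ← hc, RCLike.ofReal_re]
      exact hy
    rwa [← hO_eq] at this
  obtain ⟨z, hzO, hz⟩ := mem_closure_iff.1 (c • y).2 O hO hyO
  have hz' : (⟨z, Submodule.le_topologicalClosure _ hz⟩ : XA 𝕜 𝒜) ∈
      {x : XA 𝕜 𝒜 | ‖x‖ < 1 ∧ ρ < RCLike.re (ψ x)} := by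
    rw [← hO_eq]
    exact hzO
  exact ⟨_, hz, hz'.1.le, hz'.2⟩

/-- Along a bounded weak-star null sequence of functionals of norm larger than `ρ` there are
disjointly supported unit vectors almost attaining half of the norms. -/
lemma exists_disjoint_blocks (h_inf : ∀ A ∈ 𝒜, A.Infinite)
    (h_ad : ∀ A ∈ 𝒜, ∀ A' ∈ 𝒜, A ≠ A' → (A ∩ A').Finite) {ψ : ℕ → XA 𝕜 𝒜 →L[𝕜] 𝕜} {M : ℝ}
    (hM : ∀ k, ‖ψ k‖ ≤ M) (hψ : ∀ x, Tendsto (fun k => ψ k x) atTop (𝓝 0)) {ρ ρ' : ℝ}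
    (hρ : ∀ k, ρ < ‖ψ k‖) (hρ' : ρ' < ρ / 2) :
    ∃ (k : ℕ → ℕ) (x : ℕ → XA 𝕜 𝒜), StrictMono k ∧ (∀ i, ‖x i‖ ≤ 1) ∧
      (∀ i j, i < j → ∀ n, (x i : lp (fun _ : ℕ => 𝕜) ∞) n = 0 ∨
        (x j : lp (fun _ : ℕ => 𝕜) ∞) n = 0) ∧
      ∀ i, ρ' < RCLike.re (ψ (k i) (x i)) := by
  classical
  obtain ⟨η, hη, hηρ⟩ : ∃ η : ℝ, 0 < η ∧ ρ' + 2 * η ≤ ρ / 2 :=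
    ⟨(ρ / 2 - ρ') / 2, by linarith, by linarith⟩
  obtain ⟨𝓔, h𝓔, hexh⟩ := exists_finset_frequently_re_le h_ad hM hψ hη
  obtain ⟨H, hsep⟩ : ∃ H : Finset ℕ, ∀ A ∈ 𝓔, ∀ B ∈ 𝓔, A ≠ B → A ∩ B ⊆ H := by
    have h : (⋃ A ∈ 𝓔, ⋃ B ∈ 𝓔.erase A, A ∩ B).Finite :=
      𝓔.finite_toSet.biUnion fun A hA => (𝓔.erase A).finite_toSet.biUnion fun B hB =>
        h_ad A (h𝓔 A hA) B (h𝓔 B (Finset.mem_of_mem_erase hB)) (Finset.ne_of_mem_erase hB).symm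
    refine ⟨h.toFinset, fun A hA B hB hAB n hn => ?_⟩
    rw [Set.Finite.coe_toFinset]
    exact Set.mem_biUnion hA (Set.mem_biUnion (Finset.mem_erase.2 ⟨hAB.symm, hB⟩) hn)
  obtain ⟨f, hf, hfr⟩ := exists_seq_of_forall_finset_exists
    (fun p : ℕ × XA 𝕜 𝒜 => ‖p.2‖ ≤ 1 ∧ ρ' < RCLike.re (ψ p.1 p.2) ∧
      ∃ (𝓔' : Finset (Set ℕ)) (H' : Finset ℕ), (∀ A ∈ 𝓔', A ∈ 𝒜 ∧ A ∉ 𝓔) ∧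
        VanishesOff (p.2 : lp (fun _ : ℕ => 𝕜) ∞) (finUnion 𝓔' H'))
    (fun p q => p.1 < q.1 ∧ ∀ n, (p.2 : lp (fun _ : ℕ => 𝕜) ∞) n = 0 ∨
        (q.2 : lp (fun _ : ℕ => 𝕜) ∞) n = 0) (by
    intro s hs
    obtain ⟨𝓔', H', K, h𝓔', hsS⟩ : ∃ (𝓔' : Finset (Set ℕ)) (H' : Finset ℕ) (K : ℕ),
        (∀ A ∈ 𝓔', A ∈ 𝒜 ∧ A ∉ 𝓔) ∧ ∀ p ∈ s, p.1 ≤ K ∧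
          VanishesOff (p.2 : lp (fun _ : ℕ => 𝕜) ∞) (finUnion 𝓔' H') := by
      induction s using Finset.induction_on with
      | empty => exact ⟨∅, ∅, 0, by simp, by simp⟩
      | insert p s _ ih =>
        obtain ⟨𝓔₁, H₁, K, h₁, h⟩ := ih fun q hq => hs q (Finset.mem_insert_of_mem hq)
        obtain ⟨-, -, 𝓔₂, H₂, h₂, hp⟩ := hs p (Finset.mem_insert_self p s)
        refine ⟨𝓔₁ ∪ 𝓔₂, H₁ ∪ H₂, max K p.1,
          fun A hA => (Finset.mem_union.1 hA).elim (h₁ A) (h₂ A), fun q hq => ?_⟩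
        rcases Finset.mem_insert.1 hq with rfl | hq
        · exact ⟨le_max_right _ _, hp.mono
            (finUnion_mono Finset.subset_union_right Finset.subset_union_right)⟩
        · exact ⟨(h q hq).1.trans (le_max_left _ _), (h q hq).2.mono
            (finUnion_mono Finset.subset_union_left Finset.subset_union_left)⟩
    obtain ⟨k, hk, hkP, hkK⟩ := ((hexh 𝓔' H' h𝓔').and_eventually
      ((eventually_norm_apply_finProj_le hψ h𝓔 H hη).and (eventually_gt_atTop K))).exists
    obtain ⟨x, hxspan, hx1, hx⟩ := exists_mem_span_lt_re (ψ k) (hρ k)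
    obtain ⟨𝓔'', H'', h𝓔'', hxS⟩ := exists_vanishesOff_sub_finProj h_inf h_ad h𝓔 hsep hxspan
    let y : XA 𝕜 𝒜 :=
      ⟨finProj 𝕜 𝓔 H x, finProj_mem_XA h𝓔 H (x : lp (fun _ : ℕ => 𝕜) ∞)⟩
    let u : XA 𝕜 𝒜 := ((1 / 2 : ℝ) : 𝕜) • (x - y)
    let v : XA 𝕜 𝒜 := ⟨u * indLinf 𝕜 (finUnion 𝓔' H'),
      mul_indLinf_finUnion_mem_XA h_ad 𝓔' (fun A hA => (h𝓔' A hA).1) H' u.2⟩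
    have hu1 : ‖u‖ ≤ 1 := by
      have h1 : ‖x - y‖ ≤ 2 * ‖x‖ := norm_sub_finProj_le hsep (x : lp (fun _ : ℕ => 𝕜) ∞)
      rw [norm_smul, RCLike.norm_ofReal, abs_of_pos one_half_pos]
      linarith
    have huS : VanishesOff (u : lp (fun _ : ℕ => 𝕜) ∞) (finUnion 𝓔'' H'') := hxS.smul _
    have huv : ((u - v : XA 𝕜 𝒜) : lp (fun _ : ℕ => 𝕜) ∞) =
        u * indLinf 𝕜 (finUnion 𝓔' H')ᶜ := (mul_indLinf_compl _ _).symm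
    have hv : RCLike.re (ψ k v) ≤ η :=
      hk v ((norm_mul_indLinf_le _ _).trans hu1) (vanishesOff_mul_indLinf _ _)
    have hy : RCLike.re (ψ k y) ≤ η := (RCLike.re_le_norm _).trans (hkP x hx1)
    refine ⟨(k, u - v), ⟨?_, ?_, 𝓔'', H'', h𝓔'', ?_⟩, fun p hp =>
      ⟨(hsS p hp).1.trans_lt hkK, fun n => ?_⟩⟩
    · rw [Submodule.coe_norm, huv]
      exact (norm_mul_indLinf_le _ _).trans hu1
    · have hu : RCLike.re (ψ k u) = 1 / 2 * (RCLike.re (ψ k x) - RCLike.re (ψ k y)) := by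
        rw [map_smul, smul_eq_mul, RCLike.re_ofReal_mul, map_sub, map_sub]
      simp only [map_sub]
      linarith
    · rw [huv]
      exact huS.mul_right _
    · rw [or_iff_not_imp_left]
      intro hn
      have hnS : n ∈ finUnion 𝓔' H' := by
        by_contra h
        exact hn ((hsS p hp).2 n h)
      rw [huv, mul_indLinf_apply, Set.indicator_of_notMem]
      simpa using hnS)
  exact ⟨fun i => (f i).1, fun i => (f i).2, strictMono_nat_of_lt_succ fun i =>
    (hfr i (i + 1) i.lt_succ_self).1, fun i => (hf i).1, fun i j hij => (hfr i j hij).2,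
    fun i => (hf i).2.1⟩

lemma ZeroAtInftyContinuousMap.norm_apply_le (a : C₀(ℕ, 𝕜)) (i : ℕ) : ‖a i‖ ≤ ‖a‖ := by
  rw [← ZeroAtInftyContinuousMap.norm_toBCF_eq_norm]
  exact a.toBCF.norm_coe_le_norm i

lemma ZeroAtInftyContinuousMap.norm_le_of_forall {a : C₀(ℕ, 𝕜)} {b : ℝ} (hb : 0 ≤ b)
    (h : ∀ i, ‖a i‖ ≤ b) : ‖a‖ ≤ b := by
  rw [← ZeroAtInftyContinuousMap.norm_toBCF_eq_norm]
  exact (BoundedContinuousFunction.norm_le hb).2 h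

lemma ZeroAtInftyContinuousMap.tendsto_atTop (a : C₀(ℕ, 𝕜)) : Tendsto a atTop (𝓝 0) := by
  have h := a.zero_at_infty'
  rwa [Filter.cocompact_eq_cofinite, Nat.cofinite_eq_atTop] at h

section Factorization

variable {E : Type*} [NormedAddCommGroup E] [NormedSpace 𝕜 E]

/-- A bounded weak-star null sequence of functionals induces an operator into `c₀`. -/
lemma exists_clm_to_zeroAtInfty {θ : ℕ → E →L[𝕜] 𝕜} {b : ℝ} (hb : ∀ i, ‖θ i‖ ≤ b)
    (hθ : ∀ x, Tendsto (fun i => θ i x) atTop (𝓝 0)) :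
    ∃ U : E →L[𝕜] C₀(ℕ, 𝕜), ‖U‖ ≤ b ∧ ∀ x i, U x i = θ i x := by
  have hb0 : 0 ≤ b := (norm_nonneg _).trans (hb 0)
  let L : E →ₗ[𝕜] C₀(ℕ, 𝕜) :=
    { toFun := fun x => ⟨⟨fun i => θ i x, continuous_of_discreteTopology⟩, by
        rw [Filter.cocompact_eq_cofinite, Nat.cofinite_eq_atTop]
        exact hθ x⟩
      map_add' := fun x y => by
        ext i
        exact map_add (θ i) x y
      map_smul' := fun c x => by
        ext i
        exact map_smul (θ i) c x }
  have hL (x : E) : ‖L x‖ ≤ b * ‖x‖ :=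
    ZeroAtInftyContinuousMap.norm_le_of_forall (by positivity)
      fun i => (θ i).le_of_opNorm_le (hb i) x
  exact ⟨L.mkContinuous b hL, L.mkContinuous_norm_le hb0 hL, fun x i => rfl⟩

/-- A sequence with an upper `c₀`-estimate induces an operator on `c₀`. -/
lemma exists_clm_of_zeroAtInfty [CompleteSpace E] {x : ℕ → E}
    (hx : ∀ (t : Finset ℕ) (c : ℕ → 𝕜) (m : ℝ), 0 ≤ m → (∀ i ∈ t, ‖c i‖ ≤ m) →
      ‖∑ i ∈ t, c i • x i‖ ≤ m) :
    ∃ V : C₀(ℕ, 𝕜) →L[𝕜] E, ‖V‖ ≤ 1 ∧ ∀ a : C₀(ℕ, 𝕜), HasSum (fun i => a i • x i) (V a) := by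
  have hsum (a : C₀(ℕ, 𝕜)) : Summable fun i => a i • x i := by
    rw [summable_iff_vanishing_norm]
    intro ε hε
    obtain ⟨N, hN⟩ := Metric.tendsto_atTop.1 a.tendsto_atTop (ε / 2) (half_pos hε)
    refine ⟨Finset.range N, fun t ht => (hx t a (ε / 2) (half_pos hε).le fun i hi => ?_).trans_lt
      (half_lt_self hε)⟩
    have hi' : N ≤ i := by
      simpa using Finset.disjoint_left.1 ht hi
    simpa using (hN i hi').le
  let L : C₀(ℕ, 𝕜) →ₗ[𝕜] E :=
    { toFun := fun a => ∑' i, a i • x i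
      map_add' := fun a b => by
        rw [← (hsum a).tsum_add (hsum b)]
        exact tsum_congr fun i => add_smul _ _ _
      map_smul' := fun c a => by
        rw [RingHom.id_apply, ← (hsum a).tsum_const_smul]
        exact tsum_congr fun i => mul_smul _ _ _ }
  have hL (a : C₀(ℕ, 𝕜)) : ‖L a‖ ≤ 1 * ‖a‖ := by
    rw [one_mul]
    exact le_of_tendsto' (hsum a).hasSum.norm fun t =>
      hx t a ‖a‖ (norm_nonneg a) fun i _ => a.norm_apply_le i
  exact ⟨L.mkContinuous 1 hL, L.mkContinuous_norm_le zero_le_one hL, fun a => (hsum a).hasSum⟩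

lemma tendsto_apply_zero_of_upper_estimate {x : ℕ → E}
    (hx : ∀ (t : Finset ℕ) (c : ℕ → 𝕜) (m : ℝ), 0 ≤ m → (∀ i ∈ t, ‖c i‖ ≤ m) →
      ‖∑ i ∈ t, c i • x i‖ ≤ m) (ψ : E →L[𝕜] 𝕜) :
    Tendsto (fun i => ψ (x i)) atTop (𝓝 0) := by
  choose c hc1 hc using fun i => RCLike.exists_norm_eq_mul_self (ψ (x i))
  have hsum : Summable fun i => ‖ψ (x i)‖ := by
    refine summable_of_sum_le (c := ‖ψ‖) (fun i => norm_nonneg _) fun t => ?_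
    have h1 : ((∑ i ∈ t, ‖ψ (x i)‖ : ℝ) : 𝕜) = ψ (∑ i ∈ t, c i • x i) := by
      rw [map_sum, RCLike.ofReal_sum]
      exact Finset.sum_congr rfl fun i _ => by rw [hc, map_smul, smul_eq_mul]
    have h2 : ‖((∑ i ∈ t, ‖ψ (x i)‖ : ℝ) : 𝕜)‖ ≤ ‖ψ‖ * 1 := by
      rw [h1]
      exact ψ.le_opNorm_of_le (hx t c 1 zero_le_one fun i _ => (hc1 i).le)
    rw [mul_one, RCLike.norm_ofReal] at h2
    exact (le_abs_self _).trans h2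
  exact tendsto_zero_iff_norm_tendsto_zero.2 hsum.tendsto_atTop_zero

/-- From an infinite matrix with null rows and columns one can select a submatrix whose
off-diagonal part is small. -/
lemma exists_strictMono_offDiag_le {a : ℕ → ℕ → ℝ} (hrow : ∀ p, Tendsto (a p) atTop (𝓝 0))
    (hcol : ∀ p, Tendsto (fun q => a q p) atTop (𝓝 0)) {η : ℝ} (hη : 0 < η) :
    ∃ s : ℕ → ℕ, StrictMono s ∧ ∀ i l, i ≠ l → a (s i) (s l) ≤ η / 2 / 2 ^ l := by
  obtain ⟨f, -, hf⟩ := exists_seq_of_forall_finset_exists (fun _ : ℕ × ℕ => True)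
    (fun u v => u.1 < v.1 ∧ u.2 < v.2 ∧ a u.2 v.2 ≤ η / 2 / 2 ^ v.1 ∧
      a v.2 u.2 ≤ η / 2 / 2 ^ v.1) (by
    intro t _
    obtain ⟨j, hj⟩ : ∃ j, ∀ u ∈ t, u.1 < j :=
      ⟨t.sup Prod.fst + 1, fun u hu => Nat.lt_succ_of_le (Finset.le_sup (f := Prod.fst) hu)⟩
    have hpos : 0 < η / 2 / 2 ^ j := by positivity
    have h : ∀ᶠ q in atTop, ∀ u ∈ t, u.2 < q ∧ a u.2 q ≤ η / 2 / 2 ^ j ∧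
        a q u.2 ≤ η / 2 / 2 ^ j :=
      (Filter.eventually_all_finset t).2 fun u _ => (eventually_gt_atTop u.2).and
        (((hrow u.2).eventually_le_const hpos).and ((hcol u.2).eventually_le_const hpos))
    obtain ⟨q, hq⟩ := h.exists
    exact ⟨(j, q), trivial, fun u hu => ⟨hj u hu, hq u hu⟩⟩)
  have hmono : StrictMono fun i => (f i).1 :=
    strictMono_nat_of_lt_succ fun i => (hf i (i + 1) i.lt_succ_self).1
  have hle {l m : ℕ} (hlm : l ≤ m) : η / 2 / 2 ^ (f m).1 ≤ η / 2 / 2 ^ l :=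
    div_le_div_of_nonneg_left (half_pos hη).le (by positivity)
      (pow_le_pow_right₀ one_le_two (hlm.trans hmono.le_apply))
  refine ⟨fun i => (f i).2, strictMono_nat_of_lt_succ fun i => (hf i (i + 1) i.lt_succ_self).2.1,
    fun i l hil => ?_⟩
  rcases hil.lt_or_gt with h | h
  · exact (hf i l h).2.2.1.trans (hle le_rfl)
  · exact (hf l i h).2.2.2.trans (hle h.le)

/-- An endomorphism of a Banach space at distance less than one from the identity has a left
inverse of controlled norm. -/
lemma exists_leftInverse_norm_le {F : Type*} [NormedAddCommGroup F] [NormedSpace 𝕜 F]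
    [CompleteSpace F] {S : F →L[𝕜] F} {δ : ℝ} (hδ : δ < 1)
    (hS : ‖ContinuousLinearMap.id 𝕜 F - S‖ ≤ δ) :
    ∃ W : F →L[𝕜] F, W ∘L S = ContinuousLinearMap.id 𝕜 F ∧ ‖W‖ ≤ (1 - δ)⁻¹ := by
  obtain ⟨u, hu⟩ := isUnit_one_sub_of_norm_lt_one
    (x := ContinuousLinearMap.id 𝕜 F - S) (hS.trans_lt hδ)
  have huS : (u : F →L[𝕜] F) = S := hu.trans (sub_sub_cancel _ _)
  let W : F →L[𝕜] F := ↑u⁻¹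
  have hWS : W ∘L S = ContinuousLinearMap.id 𝕜 F := by
    rw [← huS]
    exact u.inv_mul
  refine ⟨W, hWS, ?_⟩
  have hW : W = ContinuousLinearMap.id 𝕜 F + W ∘L (ContinuousLinearMap.id 𝕜 F - S) := by
    rw [ContinuousLinearMap.comp_sub, hWS, ContinuousLinearMap.comp_id, add_sub_cancel]
  have h1 : ‖W‖ ≤ 1 + ‖W‖ * δ := by
    calc ‖W‖ = ‖ContinuousLinearMap.id 𝕜 F + W ∘L (ContinuousLinearMap.id 𝕜 F - S)‖ :=
          congrArg norm hW
      _ ≤ ‖ContinuousLinearMap.id 𝕜 F‖ + ‖W ∘L (ContinuousLinearMap.id 𝕜 F - S)‖ :=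
          norm_add_le _ _
      _ ≤ 1 + ‖W‖ * δ := add_le_add ContinuousLinearMap.norm_id_le
          ((ContinuousLinearMap.opNorm_comp_le _ _).trans
            (mul_le_mul_of_nonneg_left hS (norm_nonneg _)))
  rw [← one_div, le_div_iff₀ (by linarith)]
  linarith

/-- The identity of `c₀` factors through `T` as soon as a bounded weak-star null sequence of
functionals, composed with `T`, is bounded below on a sequence with an upper `c₀`-estimate. -/
lemma exists_factorization_zeroAtInfty [CompleteSpace E] (T : E →L[𝕜] E) {φ : ℕ → E →L[𝕜] 𝕜}
    {b : ℝ} (hb : ∀ k, ‖φ k‖ ≤ b) (hφ : ∀ x, Tendsto (fun k => φ k x) atTop (𝓝 0)) {x : ℕ → E}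
    (hx : ∀ (t : Finset ℕ) (c : ℕ → 𝕜) (m : ℝ), 0 ≤ m → (∀ i ∈ t, ‖c i‖ ≤ m) →
      ‖∑ i ∈ t, c i • x i‖ ≤ m) {ρ : ℝ} (hρ0 : 0 < ρ) (hρ : ∀ i, ρ ≤ ‖φ i (T (x i))‖) {C : ℝ}
    (hC : b / ρ < C) :
    ∃ (U : E →L[𝕜] C₀(ℕ, 𝕜)) (V : C₀(ℕ, 𝕜) →L[𝕜] E),
      U ∘L T ∘L V = ContinuousLinearMap.id 𝕜 C₀(ℕ, 𝕜) ∧ ‖U‖ * ‖V‖ < C := by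
  have hb0 : 0 ≤ b := (norm_nonneg _).trans (hb 0)
  have hC0 : 0 < C := (by positivity : 0 ≤ b / ρ).trans_lt hC
  obtain ⟨δ, hδ0, hδ1, hδ⟩ : ∃ δ : ℝ, 0 < δ ∧ δ < 1 ∧ b / ρ < C * (1 - δ) := by
    obtain ⟨d, hd, hdC⟩ := exists_between ((div_lt_one hC0).2 hC)
    have hd0 : 0 ≤ d := (by positivity : 0 ≤ b / ρ / C).trans hd.le
    obtain ⟨e, he, he1⟩ := exists_between hdC
    refine ⟨1 - e, by linarith, by linarith, ?_⟩
    rw [sub_sub_cancel, mul_comm, ← div_lt_iff₀ hC0]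
    exact hd.trans he
  obtain ⟨s, hs, hsa⟩ := exists_strictMono_offDiag_le (a := fun p q => ‖φ p (T (x q))‖)
    (fun p => tendsto_zero_iff_norm_tendsto_zero.1
      (tendsto_apply_zero_of_upper_estimate hx (φ p ∘L T)))
    (fun p => tendsto_zero_iff_norm_tendsto_zero.1 (hφ (T (x p)))) (mul_pos hδ0 hρ0)
  obtain ⟨V, hV1, hV⟩ := exists_clm_of_zeroAtInfty (𝕜 := 𝕜) (x := x ∘ s) fun t c m hm hc => by
    have h := hx (t.map ⟨s, hs.injective⟩) (fun j => c (Function.invFun s j)) m hm fun j hj => by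
      obtain ⟨i, hi, rfl⟩ := Finset.mem_map.1 hj
      simpa [Function.leftInverse_invFun hs.injective i] using hc i hi
    simpa [Function.leftInverse_invFun hs.injective _] using h
  have hd0 (i : ℕ) : φ i (T (x i)) ≠ 0 := norm_pos_iff.1 (hρ0.trans_le (hρ i))
  have hinv (i : ℕ) : ‖(φ i (T (x i)))⁻¹‖ ≤ ρ⁻¹ := by
    rw [norm_inv]
    exact inv_anti₀ hρ0 (hρ i)
  obtain ⟨U, hU1, hU⟩ := exists_clm_to_zeroAtInfty
    (θ := fun i => (φ (s i) (T (x (s i))))⁻¹ • φ (s i)) (b := b / ρ)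
    (fun i => by
      rw [norm_smul, div_eq_inv_mul]
      exact mul_le_mul (hinv _) (hb _) (norm_nonneg _) (inv_pos.2 hρ0).le)
    (fun y => by
      refine squeeze_zero_norm (fun i => ?_)
        (by simpa using ((hφ y).comp hs.tendsto_atTop).norm.const_mul ρ⁻¹)
      rw [smul_apply, norm_smul]
      exact mul_le_mul_of_nonneg_right (hinv _) (norm_nonneg _))
  have hS : ‖ContinuousLinearMap.id 𝕜 C₀(ℕ, 𝕜) - U ∘L T ∘L V‖ ≤ δ := by
    refine ContinuousLinearMap.opNorm_le_bound _ hδ0.le fun a =>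
      ZeroAtInftyContinuousMap.norm_le_of_forall (by positivity) fun i => ?_
    have h1 : HasSum (fun l => (φ (s i) (T (x (s i))))⁻¹ * (a l * φ (s i) (T (x (s l)))))
        (U (T (V a)) i) := by
      rw [hU]
      have h := ((hV a).mapL (φ (s i) ∘L T)).mul_left (φ (s i) (T (x (s i))))⁻¹
      simpa using h
    have h2 : HasSum (fun l => if l = i then a l else 0) (a i) := by
      simpa using hasSum_single (f := fun l => if l = i then a l else 0) i fun l hl => if_neg hl
    refine (HasSum.norm_le_of_bounded (h2.sub h1) ((hasSum_geometric_two' δ).mul_right ‖a‖)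
      fun l => ?_)
    rcases eq_or_ne l i with rfl | hli
    · rw [if_pos rfl, mul_left_comm, inv_mul_cancel₀ (hd0 _), mul_one, sub_self, norm_zero]
      positivity
    · rw [if_neg hli, zero_sub, norm_neg, norm_mul, norm_mul]
      calc ‖(φ (s i) (T (x (s i))))⁻¹‖ * (‖a l‖ * ‖φ (s i) (T (x (s l)))‖)
          ≤ ρ⁻¹ * (‖a‖ * (δ * ρ / 2 / 2 ^ l)) := by
            gcongr
            exacts [hinv _, a.norm_apply_le l, hsa i l hli.symm]
        _ = δ / 2 / 2 ^ l * ‖a‖ := by field_simp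
  obtain ⟨W, hW, hW1⟩ := exists_leftInverse_norm_le hδ1 hS
  refine ⟨W ∘L U, V, hW, ?_⟩
  have hδ2 : 0 < 1 - δ := sub_pos.2 hδ1
  calc ‖W ∘L U‖ * ‖V‖ ≤ ‖W‖ * ‖U‖ * ‖V‖ := by
        gcongr
        exact ContinuousLinearMap.opNorm_comp_le W U
    _ ≤ (1 - δ)⁻¹ * (b / ρ) * 1 := by gcongr
    _ < C := by
        rw [mul_one, inv_mul_lt_iff₀ hδ2, mul_comm]
        exact hδ

end Factorization

lemma norm_sum_smul_le_of_disjoint {x : ℕ → XA 𝕜 𝒜} (hx1 : ∀ i, ‖x i‖ ≤ 1)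
    (hx : ∀ i j, i < j → ∀ n, (x i : lp (fun _ : ℕ => 𝕜) ∞) n = 0 ∨
      (x j : lp (fun _ : ℕ => 𝕜) ∞) n = 0) (t : Finset ℕ) (c : ℕ → 𝕜) (m : ℝ) (hm : 0 ≤ m)
    (hc : ∀ i ∈ t, ‖c i‖ ≤ m) : ‖∑ i ∈ t, c i • x i‖ ≤ m := by
  rw [Submodule.coe_norm, Submodule.coe_sum]
  refine lp.norm_le_of_forall_le hm fun n => ?_
  rw [lp.coeFn_sum, Finset.sum_apply]
  by_cases h : ∃ i ∈ t, (x i : lp (fun _ : ℕ => 𝕜) ∞) n ≠ 0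
  · obtain ⟨i, hi, hn⟩ := h
    rw [Finset.sum_eq_single_of_mem i hi]
    · rw [Submodule.coe_smul, lp.coeFn_smul, Pi.smul_apply, norm_smul]
      exact (mul_le_of_le_one_right (norm_nonneg _)
        ((lp.norm_apply_le_norm ENNReal.top_ne_zero _ n).trans (hx1 i))).trans (hc i hi)
    · intro j _ hji
      have hj : (x j : lp (fun _ : ℕ => 𝕜) ∞) n = 0 := by
        rcases hji.lt_or_gt with h | h
        · exact (hx j i h n).resolve_right hn
        · exact (hx i j h n).resolve_left hn
      rw [Submodule.coe_smul, lp.coeFn_smul, Pi.smul_apply, hj, smul_zero]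
  · push Not at h
    rw [Finset.sum_eq_zero fun i hi => ?_, norm_zero]
    · exact hm
    · rw [Submodule.coe_smul, lp.coeFn_smul, Pi.smul_apply, h i hi, smul_zero]

end SpaceXA

/-- Let `𝒜` be an uncountable almost disjoint family of infinite subsets
of `ℕ`. Then for every `C > 4` and every non-compact operator `T` on `X_𝒜` with essential
norm one, there are operators `U : X_𝒜 → c₀` and `V : c₀ → X_𝒜` with `U ∘ T ∘ V = I_{c₀}`
and `‖U‖·‖V‖ < C`. -/
theorem statement17 {𝕜 : Type*} [RCLike 𝕜] (𝒜 : Set (Set ℕ))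
    (h_inf : ∀ A ∈ 𝒜, A.Infinite)
    (h_ad : ∀ A ∈ 𝒜, ∀ A' ∈ 𝒜, A ≠ A' → (A ∩ A').Finite)
    (h_unc : ¬𝒜.Countable)
    (C : ℝ) (hC : 4 < C)
    (T : ↥(XA 𝕜 𝒜) →L[𝕜] ↥(XA 𝕜 𝒜)) (hT : ¬IsCompactOperator ⇑T)
    (hTe : Metric.infDist T
      {S : ↥(XA 𝕜 𝒜) →L[𝕜] ↥(XA 𝕜 𝒜) | IsCompactOperator ⇑S} = 1) :
    ∃ (U : ↥(XA 𝕜 𝒜) →L[𝕜] C₀(ℕ, 𝕜)) (V : C₀(ℕ, 𝕜) →L[𝕜] ↥(XA 𝕜 𝒜)),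
      U ∘L T ∘L V = ContinuousLinearMap.id 𝕜 (C₀(ℕ, 𝕜)) ∧ ‖U‖ * ‖V‖ < C := by
  have hC0 : 0 < C := by linarith
  obtain ⟨ρ, hρ, hρ2⟩ : ∃ ρ : ℝ, 2 / C < ρ ∧ ρ < 1 / 2 :=
    exists_between (by rw [div_lt_div_iff₀ hC0 two_pos]; linarith)
  have hρ0 : 0 < ρ := (by positivity : 0 < 2 / C).trans hρ
  obtain ⟨r, hr, hr1⟩ : ∃ r : ℝ, 2 * ρ < r ∧ r < 1 := exists_between (by linarith)
  obtain ⟨φ, hφ2, hφ0, hφT⟩ :=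
    exists_weakStarNull_lt_norm_comp h_inf h_ad T hTe (by linarith : 0 ≤ r) hr1
  obtain ⟨k, x, hk, hx1, hx, hρx⟩ := exists_disjoint_blocks h_inf h_ad (M := 2 * ‖T‖)
    (fun k => (ContinuousLinearMap.opNorm_comp_le (φ k) T).trans
      (mul_le_mul_of_nonneg_right (hφ2 k) (norm_nonneg T)))
    (fun y => hφ0 (T y)) hφT (by linarith : ρ < r / 2)
  have : CompleteSpace (XA 𝕜 𝒜) :=
    (Submodule.isClosed_topologicalClosure _).completeSpace_coe
  exact exists_factorization_zeroAtInfty T (fun i => hφ2 (k i))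
    (fun y => (hφ0 y).comp hk.tendsto_atTop) (norm_sum_smul_le_of_disjoint hx1 hx) hρ0
    (fun i => (hρx i).le.trans (RCLike.re_le_norm _)) (by rwa [div_lt_comm₀ hρ0 hC0])
end

section
/- Let K be a scattered, locally compact Hausdorff topological space. Then the unit ball of the dual of C₀(K) is weak* sequentially compact: every sequence of bounded linear functionals on C₀(K) of norm at most one has a subsequence that converges pointwise on C₀(K) to a bounded linear functional of norm at most one. -/
open scoped ENNReal ZeroAtInfty
open Filter

/-- The dual unit ball, with the weak* topology. -/
def dualUnitBall (𝕜 E : Type*) [RCLike 𝕜] [NormedAddCommGroup E] [NormedSpace 𝕜 E] :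
    Set (WeakDual 𝕜 E) :=
  {μ | ∀ f, ‖μ f‖ ≤ ‖f‖}

section Abstract

variable {𝕜 E : Type*} [RCLike 𝕜] [NormedAddCommGroup E] [NormedSpace 𝕜 E]

theorem isCompact_dualUnitBall : IsCompact (dualUnitBall 𝕜 E) := by
  convert WeakDual.isCompact_closedBall (𝕜 := 𝕜) (E := E) 0 1 using 1
  ext μ
  simp only [dualUnitBall, Set.mem_ofPred_eq, Set.mem_preimage, mem_closedBall_zero_iff]
  rw [ContinuousLinearMap.opNorm_le_iff zero_le_one]
  simp

/-- In a compact set, a sequence along a filter admits a minimal closed set of cluster points that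
every finer countably generated filter still clusters at. -/
theorem exists_minimal_isClosed_mapClusterPt {X : Type*} [TopologicalSpace X] {B : Set X}
    (hB : IsCompact B) (hBc : IsClosed B) {x : ℕ → X} (hx : ∀ n, x n ∈ B) (l : Filter ℕ) :
    ∃ F, Minimal (· ∈ {F : Set X | IsClosed F ∧ F ⊆ B ∧ ∀ l' ≤ l, l'.NeBot →
      l'.IsCountablyGenerated → ∃ p ∈ F, MapClusterPt p l' x}) F := by
  refine (zorn_superset_nonempty _ ?_ B ?_).imp fun F hF => hF.2
  · intro c hc hchain hne
    refine ⟨⋂₀ c, ⟨isClosed_sInter fun s hs => (hc hs).1, ?_, ?_⟩,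
      fun s hs => Set.sInter_subset_of_mem hs⟩
    · obtain ⟨s, hs⟩ := hne
      exact (Set.sInter_subset_of_mem hs).trans (hc hs).2.1
    · intro l' hl' hbot hcg
      have : Nonempty c := hne.to_subtype
      have hcl : ∀ s : c, IsClosed ((s : Set X) ∩ {p | MapClusterPt p l' x}) := fun s =>
        (hc s.2).1.inter isClosed_setOfPred_clusterPt
      have hdir : Directed (· ⊇ ·) fun s : c => (s : Set X) ∩ {p | MapClusterPt p l' x} := by
        intro s t
        rcases hchain.total s.2 t.2 with h | h
        · exact ⟨s, subset_rfl, Set.inter_subset_inter_left _ h⟩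
        · exact ⟨t, Set.inter_subset_inter_left _ h, subset_rfl⟩
      obtain ⟨p, hp⟩ := IsCompact.nonempty_iInter_of_directed_nonempty_isCompact_isClosed _ hdir
        (fun s => (hc s.2).2.2 l' hl' hbot hcg)
        (fun s => hB.of_isClosed_subset (hcl s) (Set.inter_subset_left.trans (hc s.2).2.1)) hcl
      rw [Set.mem_iInter] at hp
      exact ⟨p, fun s hs => (hp ⟨s, hs⟩).1, (hp (Classical.arbitrary c)).2⟩
  · refine ⟨hBc, subset_rfl, fun l' _ _ _ => ?_⟩
    exact hB.exists_mapClusterPt (tendsto_principal.2 (.of_forall hx))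

/-- Norm-fragmentability of the dual unit ball in the weak* topology. -/
def DualBallFragmented (𝕜 E : Type*) [RCLike 𝕜] [NormedAddCommGroup E] [NormedSpace 𝕜 E] : Prop :=
  ∀ ε > 0, ∀ F ⊆ dualUnitBall 𝕜 E, F.Nonempty → ∃ V, IsOpen V ∧ (V ∩ F).Nonempty ∧
    ∀ μ ∈ V ∩ F, ∀ ν ∈ V ∩ F, ∀ f : E, ‖f‖ ≤ 1 → ‖μ f - ν f‖ ≤ ε

theorem DualBallFragmented.exists_finer_filter (hfrag : DualBallFragmented 𝕜 E)
    {x : ℕ → WeakDual 𝕜 E} (hx : ∀ n, x n ∈ dualUnitBall 𝕜 E) {ε : ℝ} (hε : 0 < ε)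
    (l : Filter ℕ) [l.NeBot] [l.IsCountablyGenerated] :
    ∃ l' ≤ l, l'.NeBot ∧ l'.IsCountablyGenerated ∧ ∃ p : WeakDual 𝕜 E, ∀ f : E, ‖f‖ ≤ 1 →
      ∀ᶠ n in l', ‖x n f - p f‖ ≤ 2 * ε := by
  obtain ⟨F, ⟨hFc, hFB, hF⟩, hmin⟩ := exists_minimal_isClosed_mapClusterPt
    isCompact_dualUnitBall isCompact_dualUnitBall.isClosed hx l
  have hne : F.Nonempty := by
    obtain ⟨p, hp, -⟩ := hF l le_rfl inferInstance inferInstance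
    exact ⟨p, hp⟩
  obtain ⟨V, hV, ⟨p, hp⟩, hsmall⟩ := hfrag ε hε F hFB hne
  have hnot : ¬ ∀ l' ≤ l, l'.NeBot → l'.IsCountablyGenerated →
      ∃ q ∈ F \ V, MapClusterPt q l' x := fun h =>
    (hmin ⟨hFc.sdiff hV, Set.sdiff_subset.trans hFB, h⟩ Set.sdiff_subset hp.2).2 hp.1
  push Not at hnot
  obtain ⟨l', hl', hbot, hcg, hl'V⟩ := hnot
  refine ⟨l', hl', hbot, hcg, p, fun f hf => ?_⟩
  by_contra hfreq
  rw [not_eventually] at hfreq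
  have hbot' : (l' ⊓ 𝓟 {n | ¬ ‖x n f - p f‖ ≤ 2 * ε}).NeBot := frequently_mem_iff_neBot.1 hfreq
  obtain ⟨q, hqF, hq⟩ := hF (l' ⊓ 𝓟 {n | ¬ ‖x n f - p f‖ ≤ 2 * ε})
    (inf_le_left.trans hl') hbot' inferInstance
  have hqV : q ∈ V := by
    by_contra h
    exact hl'V q ⟨hqF, h⟩ (hq.mono inf_le_left)
  have hqp := hsmall q ⟨hqV, hqF⟩ p hp f hf
  have hopen : IsOpen {ν : WeakDual 𝕜 E | ‖ν f - p f‖ < 2 * ε} :=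
    isOpen_lt (((WeakDual.eval_continuous f).sub continuous_const).norm) continuous_const
  have hfr := hq.frequently (hopen.mem_nhds (show ‖q f - p f‖ < 2 * ε by linarith))
  have hev : ∀ᶠ n in l' ⊓ 𝓟 {n | ¬ ‖x n f - p f‖ ≤ 2 * ε}, ¬ ‖x n f - p f‖ ≤ 2 * ε :=
    mem_inf_of_right (mem_principal_self _)
  obtain ⟨n, hn, hn'⟩ := (hfr.and_eventually hev).exists
  exact hn' (le_of_lt hn)

/-- If the dual unit ball is norm-fragmented, then it is weak* sequentially compact. -/
theorem DualBallFragmented.exists_subseq_tendsto (hfrag : DualBallFragmented 𝕜 E)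
    {x : ℕ → WeakDual 𝕜 E} (hx : ∀ n, x n ∈ dualUnitBall 𝕜 E) :
    ∃ ρ : ℕ → ℕ, StrictMono ρ ∧ ∃ p ∈ dualUnitBall 𝕜 E,
      ∀ f : E, Tendsto (fun n => x (ρ n) f) atTop (nhds (p f)) := by
  have step : ∀ (k : ℕ) (l : {l : Filter ℕ // l.NeBot ∧ l.IsCountablyGenerated}),
      ∃ l' : {l : Filter ℕ // l.NeBot ∧ l.IsCountablyGenerated}, l'.1 ≤ l.1 ∧
        ∃ p : WeakDual 𝕜 E, ∀ f : E, ‖f‖ ≤ 1 →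
          ∀ᶠ n in l'.1, ‖x n f - p f‖ ≤ 2 * (1 / ((k : ℝ) + 1)) := by
    rintro k ⟨l, h₁, h₂⟩
    obtain ⟨l', hl', h₁', h₂', hp⟩ := hfrag.exists_finer_filter hx
      (Nat.one_div_pos_of_nat (α := ℝ) (n := k)) l
    exact ⟨⟨l', h₁', h₂'⟩, hl', hp⟩
  choose next hnext p hp using step
  let L : ℕ → {l : Filter ℕ // l.NeBot ∧ l.IsCountablyGenerated} :=
    fun n => Nat.rec ⟨atTop, inferInstance, inferInstance⟩ next n
  have hLanti : Antitone fun n => (L n).1 := antitone_nat_of_succ_le fun n => hnext n (L n)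
  have hbot : ∀ n, (L n).1.NeBot := fun n => (L n).2.1
  have hcg : ∀ n, (L n).1.IsCountablyGenerated := fun n => (L n).2.2
  have : (⨅ n, (L n).1).NeBot := iInf_neBot_of_directed' hLanti.directed_ge hbot
  obtain ⟨d, hd⟩ := exists_seq_tendsto (⨅ n, (L n).1)
  have hd_top : Tendsto d atTop atTop := hd.mono_right (iInf_le (fun n => (L n).1) 0)
  obtain ⟨φ, hφ, hdφ⟩ := strictMono_subseq_of_tendsto_atTop hd_top
  obtain ⟨q, hq, hqcl⟩ := (isCompact_dualUnitBall (𝕜 := 𝕜) (E := E)).exists_mapClusterPt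
    (f := atTop) (u := fun n => x (d (φ n))) (by simp [hx])
  refine ⟨d ∘ φ, hdφ, q, hq, ?_⟩
  have key : ∀ f : E, ‖f‖ ≤ 1 → Tendsto (fun n => x (d (φ n)) f) atTop (nhds (q f)) := by
    intro f hf
    have hcauchy : CauchySeq fun n => x (d (φ n)) f := by
      rw [Metric.cauchySeq_iff']
      intro ε hε
      obtain ⟨k, hk⟩ := exists_nat_one_div_lt (show 0 < ε / 4 by positivity)
      have hlim : Tendsto (fun n => d (φ n)) atTop (L (k + 1)).1 :=
        (hd.comp hφ.tendsto_atTop).mono_right (iInf_le (fun n => (L n).1) (k + 1))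
      obtain ⟨N, hN⟩ := eventually_atTop.1 (hlim.eventually (hp k (L k) f hf))
      refine ⟨N, fun n hn => ?_⟩
      have h₁ := hN n hn
      have h₂ := hN N le_rfl
      rw [← dist_eq_norm] at h₁ h₂
      have := dist_triangle_right (x (d (φ n)) f) (x (d (φ N)) f) (p k (L k) f)
      linarith
    exact le_nhds_of_cauchy_adhp hcauchy
      (hqcl.continuousAt_comp (WeakDual.eval_continuous f).continuousAt)
  intro f
  have hpos : 0 < ‖f‖ + 1 := by positivity
  have hc : ((‖f‖ + 1 : ℝ) : 𝕜) ≠ 0 := by exact_mod_cast hpos.ne'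
  have h := (key ((((‖f‖ + 1 : ℝ) : 𝕜)⁻¹) • f) (by
    rw [norm_smul, norm_inv, RCLike.norm_ofReal, abs_of_pos hpos, inv_mul_le_iff₀ hpos]
    linarith)).const_mul ((‖f‖ + 1 : ℝ) : 𝕜)
  simpa only [map_smul, smul_eq_mul, mul_inv_cancel_left₀ hc, Function.comp_apply] using h

end Abstract

section Scattered

variable {𝕜 : Type*} [RCLike 𝕜] {K : Type*} [TopologicalSpace K]

namespace ZeroAtInftyContinuousMap

theorem norm_apply_le_s18 (f : C₀(K, 𝕜)) (x : K) : ‖f x‖ ≤ ‖f‖ :=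
  f.toBCF.norm_coe_le_norm x

theorem norm_le_of_forall_le (f : C₀(K, 𝕜)) {c : ℝ} (hc : 0 ≤ c) (h : ∀ x, ‖f x‖ ≤ c) :
    ‖f‖ ≤ c :=
  (BoundedContinuousFunction.norm_le hc).2 h

theorem isCompact_setOf_le_norm (f : C₀(K, 𝕜)) {δ : ℝ} (hδ : 0 < δ) :
    IsCompact {x | δ ≤ ‖f x‖} := by
  have h := f.zero_at_infty'.norm.eventually (gt_mem_nhds (by simpa using hδ))
  obtain ⟨C, hC, hCs⟩ := mem_cocompact.1 h
  refine hC.of_isClosed_subset (isClosed_le continuous_const (map_continuous f).norm) fun x hx => ?_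
  by_contra hxC
  have hlt : ‖f x‖ < δ := hCs hxC
  exact hlt.not_ge hx

/-- Urysohn's lemma in `C₀(K, 𝕜)`. -/
theorem exists_one_of_isCompact [LocallyCompactSpace K] [T2Space K] {C U : Set K}
    (hC : IsCompact C) (hU : IsOpen U) (hCU : C ⊆ U) :
    ∃ φ : C₀(K, 𝕜), (∀ x ∈ C, φ x = 1) ∧ (∀ x ∉ U, φ x = 0) ∧ (∀ x, ‖φ x‖ ≤ 1) ∧
      ∀ x, ‖1 - φ x‖ ≤ 1 := by
  obtain ⟨φ, h₁, h₀, hs, hI⟩ := exists_continuous_one_zero_of_isCompact hC hU.isClosed_compl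
    (Set.disjoint_compl_right_iff_subset.2 hCU)
  have hs' : HasCompactSupport fun x => ((φ x : ℝ) : 𝕜) := hs.comp_left (g := RCLike.ofReal) (by simp)
  refine ⟨⟨⟨fun x => ((φ x : ℝ) : 𝕜), by fun_prop⟩, hs'.is_zero_at_infty⟩, fun x hx => ?_,
    fun x hx => ?_, fun x => ?_, fun x => ?_⟩
  · simp [h₁ hx]
  · simp [h₀ hx]
  · change ‖((φ x : ℝ) : 𝕜)‖ ≤ 1
    rw [RCLike.norm_ofReal, abs_of_nonneg (hI x).1]
    exact (hI x).2
  · change ‖1 - ((φ x : ℝ) : 𝕜)‖ ≤ 1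
    rw [← RCLike.ofReal_one, ← RCLike.ofReal_sub, RCLike.norm_ofReal, abs_le]
    constructor <;> linarith [(hI x).1, (hI x).2]

end ZeroAtInftyContinuousMap

open ZeroAtInftyContinuousMap

/-- Norm-fragmentability of the dual unit ball of `C₀(K, 𝕜)`, as tested on the functions that
vanish off `U`. -/
def DualBallFragmentedOn (𝕜 : Type*) [RCLike 𝕜] {K : Type*} [TopologicalSpace K] (U : Set K) :
    Prop :=
  ∀ ε > 0, ∀ F ⊆ dualUnitBall 𝕜 C₀(K, 𝕜), F.Nonempty → ∃ V, IsOpen V ∧ (V ∩ F).Nonempty ∧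
    ∀ μ ∈ V ∩ F, ∀ ν ∈ V ∩ F, ∀ f : C₀(K, 𝕜), (∀ x ∉ U, f x = 0) → ‖f‖ ≤ 1 → ‖μ f - ν f‖ ≤ ε

theorem dualBallFragmentedOn_empty : DualBallFragmentedOn 𝕜 (∅ : Set K) := by
  intro ε hε F _ hF
  refine ⟨Set.univ, isOpen_univ, by simpa using hF, fun μ _ ν _ f hf _ => ?_⟩
  have : f = 0 := by
    ext x
    simpa using hf x (Set.notMem_empty x)
  simpa [this] using hε.le

theorem exists_norm_eq_one_mul_eq_norm (z : 𝕜) : ∃ c : 𝕜, ‖c‖ = 1 ∧ c * z = (‖z‖ : 𝕜) := by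
  by_cases hz : z = 0
  · exact ⟨1, by simp, by simp [hz]⟩
  · have hz' : (‖z‖ : 𝕜) ≠ 0 := by simpa using hz
    refine ⟨(‖z‖ : 𝕜) / z, by simp [hz], by field_simp⟩

/-- A nonempty set of functionals of norm at most one has a nonempty relatively weak* open subset
that is uniformly tight on a given set. -/
theorem exists_isOpen_tight {F : Set (WeakDual 𝕜 C₀(K, 𝕜))} (hFB : F ⊆ dualUnitBall 𝕜 C₀(K, 𝕜))
    (hF : F.Nonempty) (U : Set K) {δ : ℝ} (hδ : 0 < δ) :
    ∃ C ⊆ U, IsCompact C ∧ ∃ V, IsOpen V ∧ (V ∩ F).Nonempty ∧ ∀ μ ∈ V ∩ F, ∀ h : C₀(K, 𝕜),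
      (∀ x ∉ U, h x = 0) → (∀ x ∈ C, h x = 0) → ‖h‖ ≤ 1 → ‖μ h‖ ≤ 2 * δ := by
  let T : Set ℝ := {r | ∃ μ ∈ F, ∃ f : C₀(K, 𝕜), (∀ x ∉ U, f x = 0) ∧ ‖f‖ ≤ 1 ∧ r = ‖μ f‖}
  have hT1 : ∀ r ∈ T, r ≤ 1 := by
    rintro r ⟨μ, hμ, f, -, hf, rfl⟩
    exact (hFB hμ f).trans hf
  have hTbdd : BddAbove T := ⟨1, hT1⟩
  have hTne : T.Nonempty := by
    obtain ⟨μ, hμ⟩ := hF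
    exact ⟨_, μ, hμ, 0, by simp, by simp, rfl⟩
  have hs1 : sSup T ≤ 1 := csSup_le hTne hT1
  obtain ⟨-, ⟨μ₀, hμ₀, f, hfU, hf1, rfl⟩, hlt⟩ :=
    exists_lt_of_lt_csSup hTne (show sSup T - δ < sSup T by linarith)
  refine ⟨{x | δ ≤ ‖f x‖}, fun x hx => ?_, f.isCompact_setOf_le_norm hδ,
    {μ | sSup T - δ < ‖μ f‖}, isOpen_lt continuous_const (WeakDual.eval_continuous f).norm,
    ⟨μ₀, hlt, hμ₀⟩, ?_⟩
  · by_contra hxU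
    have : δ ≤ ‖f x‖ := hx
    simp only [hfU x hxU, norm_zero] at this
    linarith
  · rintro μ ⟨hμ, hμF⟩ h hU hC h1
    replace hμ : sSup T - δ < ‖μ f‖ := hμ
    obtain ⟨a, ha, haf⟩ := exists_norm_eq_one_mul_eq_norm (μ f)
    obtain ⟨b, hb, hbh⟩ := exists_norm_eq_one_mul_eq_norm (μ h)
    have hpos : 0 < 1 + δ := by linarith
    let g : C₀(K, 𝕜) := (((1 + δ : ℝ) : 𝕜)⁻¹) • (a • f + b • h)
    have hg1 : ‖g‖ ≤ 1 := by
      rw [norm_smul, norm_inv, RCLike.norm_ofReal, abs_of_pos hpos, inv_mul_le_iff₀ hpos, mul_one]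
      refine norm_le_of_forall_le _ hpos.le fun x => ?_
      have htri : ‖(a • f + b • h) x‖ ≤ ‖f x‖ + ‖h x‖ := by
        simpa [ha, hb] using norm_add_le (a * f x) (b * h x)
      have hfx := (f.norm_apply_le_s18 x).trans hf1
      have hhx := (h.norm_apply_le_s18 x).trans h1
      by_cases hx : δ ≤ ‖f x‖
      · rw [hC x hx, norm_zero] at htri
        linarith
      · linarith
    have hgU : ∀ x ∉ U, g x = 0 := fun x hx => by simp [g, hfU x hx, hU x hx]
    have hgs : ‖μ g‖ ≤ sSup T := le_csSup hTbdd ⟨μ, hμF, g, hgU, hg1, rfl⟩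
    have hval : ‖μ g‖ = (1 + δ)⁻¹ * (‖μ f‖ + ‖μ h‖) := by
      have : μ g = (((1 + δ)⁻¹ * (‖μ f‖ + ‖μ h‖) : ℝ) : 𝕜) := by
        simp only [g, map_smul, map_add, smul_eq_mul, haf, hbh]
        push_cast
        ring
      rw [this, RCLike.norm_ofReal, abs_of_nonneg (by positivity)]
    rw [hval, inv_mul_le_iff₀ hpos] at hgs
    nlinarith

theorem DualBallFragmentedOn.sUnion [LocallyCompactSpace K] [T2Space K] {c : Set (Set K)}
    (hne : c.Nonempty) (hdir : DirectedOn (· ⊆ ·) c) (hopen : ∀ U ∈ c, IsOpen U)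
    (hc : ∀ U ∈ c, DualBallFragmentedOn 𝕜 U) : DualBallFragmentedOn 𝕜 (⋃₀ c) := by
  intro ε hε F hFB hF
  obtain ⟨C, hCU, hC, V₁, hV₁, hne₁, htight⟩ :=
    exists_isOpen_tight hFB hF (⋃₀ c) (show 0 < ε / 8 by positivity)
  obtain ⟨U, hUc, hCU'⟩ : ∃ U ∈ c, C ⊆ U := by
    have : Nonempty c := hne.to_subtype
    obtain ⟨U, hU⟩ := hC.elim_directed_cover (fun U : c => (U : Set K)) (fun U => hopen U U.2)
      (by rwa [← Set.sUnion_eq_iUnion]) hdir.directed_val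
    exact ⟨U, U.2, hU⟩
  obtain ⟨V₂, hV₂, hne₂, hdiam⟩ := hc U hUc (ε / 2) (by positivity) (V₁ ∩ F)
    (Set.inter_subset_right.trans hFB) hne₁
  obtain ⟨φ, hφ₁, hφ₀, hφle, hφle'⟩ := exists_one_of_isCompact (𝕜 := 𝕜) hC (hopen U hUc) hCU'
  refine ⟨V₂ ∩ V₁, hV₂.inter hV₁, by rwa [Set.inter_assoc], fun μ hμ ν hν f hf hf1 => ?_⟩
  rw [Set.inter_assoc] at hμ hν
  have hcut : ‖f * φ‖ ≤ 1 := norm_le_of_forall_le _ zero_le_one fun x => by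
    rw [mul_apply, norm_mul]
    exact mul_le_one₀ ((f.norm_apply_le_s18 x).trans hf1) (norm_nonneg _) (hφle x)
  have hrest : ‖f - f * φ‖ ≤ 1 := norm_le_of_forall_le _ zero_le_one fun x => by
    rw [ZeroAtInftyContinuousMap.sub_apply, mul_apply,
      show f x - f x * φ x = f x * (1 - φ x) by ring, norm_mul]
    exact mul_le_one₀ ((f.norm_apply_le_s18 x).trans hf1) (norm_nonneg _) (hφle' x)
  have hrestU : ∀ x ∉ ⋃₀ c, (f - f * φ) x = 0 := fun x hx => by simp [hf x hx]
  have hrestC : ∀ x ∈ C, (f - f * φ) x = 0 := fun x hx => by simp [hφ₁ x hx]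
  have h₁ := hdiam μ hμ ν hν (f * φ) (fun x hx => by simp [hφ₀ x hx]) hcut
  have h₂ := htight μ hμ.2 (f - f * φ) hrestU hrestC hrest
  have h₃ := htight ν hν.2 (f - f * φ) hrestU hrestC hrest
  have hsplit : μ f - ν f = (μ (f * φ) - ν (f * φ)) + (μ (f - f * φ) - ν (f - f * φ)) := by
    simp only [map_sub]
    ring
  rw [hsplit]
  have h₄ := norm_add_le (μ (f * φ) - ν (f * φ)) (μ (f - f * φ) - ν (f - f * φ))
  have h₅ := norm_sub_le (μ (f - f * φ)) (ν (f - f * φ))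
  linarith

theorem DualBallFragmentedOn.insert_of_isOpen [LocallyCompactSpace K] [T2Space K] {U : Set K}
    (hU : DualBallFragmentedOn 𝕜 U) {x : K} (hopen : IsOpen (insert x U)) :
    DualBallFragmentedOn 𝕜 (insert x U) := by
  intro ε hε F hFB hF
  obtain ⟨φ, hφ₁, hφ₀, hφle, -⟩ := exists_one_of_isCompact (𝕜 := 𝕜) (isCompact_singleton (x := x))
    hopen (by simp)
  obtain ⟨V, hV, ⟨μ₀, hμ₀⟩, hdiam⟩ := hU (ε / 4) (by positivity) F hFB hF
  refine ⟨{μ | ‖μ φ - μ₀ φ‖ < ε / 4} ∩ V, IsOpen.inter (isOpen_lt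
    ((WeakDual.eval_continuous φ).sub continuous_const).norm continuous_const) hV,
    ⟨μ₀, ⟨by simpa using hε, hμ₀.1⟩, hμ₀.2⟩, ?_⟩
  rintro μ ⟨⟨hμ, hμV⟩, hμF⟩ ν ⟨⟨hν, hνV⟩, hνF⟩ f hf hf1
  replace hμ : ‖μ φ - μ₀ φ‖ < ε / 4 := hμ
  replace hν : ‖ν φ - μ₀ φ‖ < ε / 4 := hν
  let g : C₀(K, 𝕜) := (2⁻¹ : 𝕜) • (f - f x • φ)
  have hfx := (f.norm_apply_le_s18 x).trans hf1
  have hφ1 : ‖φ‖ ≤ 1 := norm_le_of_forall_le _ zero_le_one hφle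
  have hg1 : ‖g‖ ≤ 1 := by
    have h₁ := norm_sub_le f (f x • φ)
    have h₂ : ‖f x • φ‖ ≤ 1 := by
      rw [norm_smul]
      exact mul_le_one₀ hfx (norm_nonneg _) hφ1
    rw [norm_smul, norm_inv, RCLike.norm_ofNat]
    linarith
  have hgU : ∀ y ∉ U, g y = 0 := fun y hy => by
    by_cases hyx : y = x
    · simp [g, hyx, hφ₁ x rfl]
    · have : y ∉ insert x U := by simp [hyx, hy]
      simp [g, hf y this, hφ₀ y this]
  have h₁ := hdiam μ ⟨hμV, hμF⟩ ν ⟨hνV, hνF⟩ g hgU hg1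
  have hsplit : μ f - ν f = 2 * (μ g - ν g) + f x * (μ φ - ν φ) := by
    simp only [g, map_smul, map_sub, smul_eq_mul]
    field_simp
    ring
  have h₂ : ‖μ φ - ν φ‖ ≤ ε / 2 := by
    have := dist_triangle_right (μ φ) (ν φ) (μ₀ φ)
    simp only [dist_eq_norm] at this
    linarith
  have h₃ : ‖f x * (μ φ - ν φ)‖ ≤ ε / 2 := by
    rw [norm_mul]
    exact (mul_le_of_le_one_left (norm_nonneg _) hfx).trans h₂
  have h₄ : ‖2 * (μ g - ν g)‖ ≤ ε / 2 := by
    rw [norm_mul, RCLike.norm_ofNat]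
    linarith
  rw [hsplit]
  linarith [norm_add_le (2 * (μ g - ν g)) (f x * (μ φ - ν φ))]

theorem dualBallFragmented_of_scattered [LocallyCompactSpace K] [T2Space K]
    (h_scattered : ∀ S : Set K, S.Nonempty → ∃ x ∈ S, ∃ U : Set K, IsOpen U ∧ U ∩ S = {x}) :
    DualBallFragmented 𝕜 C₀(K, 𝕜) := by
  obtain ⟨U, -, hU⟩ := zorn_subset_nonempty {U : Set K | IsOpen U ∧ DualBallFragmentedOn 𝕜 U}
    (fun c hc hchain hne => ⟨⋃₀ c, ⟨isOpen_sUnion fun U hU => (hc hU).1,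
      .sUnion hne hchain.directedOn (fun U hU => (hc hU).1) fun U hU => (hc hU).2⟩,
      fun U hU => Set.subset_sUnion_of_mem hU⟩)
    ∅ ⟨isOpen_empty, dualBallFragmentedOn_empty⟩
  obtain rfl : U = Set.univ := by
    by_contra hne
    obtain ⟨x, hx, W, hW, hWx⟩ := h_scattered Uᶜ (Set.nonempty_compl.2 hne)
    have hins : insert x U = W ∪ U := by
      ext y
      have := Set.ext_iff.1 hWx y
      simp only [Set.mem_inter_iff, Set.mem_compl_iff, Set.mem_singleton_iff] at this
      simp only [Set.mem_insert_iff, Set.mem_union]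
      tauto
    have hopen : IsOpen (insert x U) := hins ▸ hW.union hU.prop.1
    exact hx (hU.le_of_ge ⟨hopen, hU.prop.2.insert_of_isOpen hopen⟩ (Set.subset_insert x U)
      (Set.mem_insert x U))
  intro ε hε F hFB hF
  obtain ⟨V, hV, hne, h⟩ := hU.prop.2 ε hε F hFB hF
  exact ⟨V, hV, hne, fun μ hμ ν hν f hf => h μ hμ ν hν f (by simp) hf⟩

end Scattered

/-- Let `K` be a scattered, locally compact Hausdorff space. Then the
unit ball of the dual of `C₀(K)` is weak* sequentially compact: every sequence of bounded
functionals of norm at most one has a subsequence converging pointwise to a bounded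
functional of norm at most one. -/
theorem statement18 {𝕜 : Type*} [RCLike 𝕜] {K : Type*} [TopologicalSpace K]
    [LocallyCompactSpace K] [T2Space K]
    (h_scattered : ∀ S : Set K, S.Nonempty → ∃ x ∈ S, ∃ U : Set K, IsOpen U ∧ U ∩ S = {x}) :
    ∀ g : ℕ → (C₀(K, 𝕜) →L[𝕜] 𝕜), (∀ n, ‖g n‖ ≤ 1) →
      ∃ ρ : ℕ → ℕ, StrictMono ρ ∧ ∃ g₀ : C₀(K, 𝕜) →L[𝕜] 𝕜, ‖g₀‖ ≤ 1 ∧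
        ∀ f : C₀(K, 𝕜), Tendsto (fun n => g (ρ n) f) atTop (nhds (g₀ f)) := by
  intro g hg
  obtain ⟨ρ, hρ, p, hp, hlim⟩ := (dualBallFragmented_of_scattered (𝕜 := 𝕜)
    h_scattered).exists_subseq_tendsto (x := fun n => StrongDual.toWeakDual (g n))
    fun n f => (g n).le_of_opNorm_le (hg n) f |>.trans_eq (one_mul _)
  refine ⟨ρ, hρ, WeakDual.toStrongDual p, ?_, hlim⟩
  exact ContinuousLinearMap.opNorm_le_bound _ zero_le_one fun f => (hp f).trans_eq (one_mul _).symm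
end
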